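/- Let D be a nonsingular CAT(0) simplicial disk spanning a closed combinatorial path α. Then 2|α₂(D)| + |α₁(D)| ≥ |α₋(D)| + 6. In particular, if no triangle moves can be applied to α (no boundary vertex has degree 2 on D), then α contains at least six more positive vertices than negative vertices. -/

import Mathlib

open scoped Classical

noncomputable section

/-! ## Abstract simplicial complexes and their piecewise Euclidean geometry

An (abstract, regular) simplicial complex on a vertex type `V` is a collection of nonempty
finite vertex sets (its simplices), closed under passage to nonempty subsets.  It is regarded
as a *regular* piecewise Euclidean complex: every `n`-simplex is isometric to the regular
Euclidean `n`-simplex with unit edge lengths, glued along faces by isometries.  This geometry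
is built into the intrinsic metric on the geometric realization defined below. -/

structure SC (V : Type*) where
  faces : Set (Finset V)
  not_mem_empty : ∅ ∉ faces
  down : ∀ s ∈ faces, ∀ t : Finset V, t ⊆ s → t ≠ ∅ → t ∈ faces

variable {V : Type*} [DecidableEq V]

/-- The complex has dimension at most `3` (every simplex has at most 4 vertices). -/
def SC.Is3Dim (K : SC V) : Prop := ∀ s ∈ K.faces, s.card ≤ 4

/-- A point of the geometric realization of `K`, in barycentric coordinates. -/
def SC.IsPoint (K : SC V) (x : V →₀ ℝ) : Prop :=
  (∀ v, 0 ≤ x v) ∧ (x.sum fun _ r => r) = 1 ∧ x.support ∈ K.faces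

/-- Two realization points lie in a common closed simplex of `K`. -/
def SC.SameCell (K : SC V) (x y : V →₀ ℝ) : Prop := x.support ∪ y.support ∈ K.faces

/-- The Euclidean distance between two points of a common *regular unit-edge* simplex, in
barycentric coordinates: realizing the vertices as `eᵥ/√2` in `ℓ²(V)` gives a regular simplex
with unit edge lengths, and the induced distance is `√(∑ (xᵥ - yᵥ)² / 2)`. -/
def stepD (x y : V →₀ ℝ) : ℝ := Real.sqrt (((x - y).sum fun _ r => r ^ 2) / 2)

/-- A chain of realization points in which consecutive points share a simplex. -/
def SC.IsChain (K : SC V) (c : List (V →₀ ℝ)) : Prop :=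
  (∀ z ∈ c, K.IsPoint z) ∧ c.Chain' K.SameCell

/-- The length of a chain of realization points. -/
def chLen (c : List (V →₀ ℝ)) : ℝ := ((c.zip c.tail).map fun p => stepD p.1 p.2).sum

/-- The intrinsic (length) metric of the regular piecewise Euclidean complex `K`:
the infimum of lengths of piecewise linear chains joining two realization points. -/
def SC.pdist (K : SC V) (x y : V →₀ ℝ) : ℝ :=
  sInf {L | ∃ c, K.IsChain c ∧ c.head? = some x ∧ c.getLast? = some y ∧ chLen c = L}

/-- `K` is CAT(0): its geometric realization with the intrinsic piecewise Euclidean metric is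
chain-connected, midpoints exist (so the metric is geodesic), and every midpoint satisfies the
Bruhat–Tits CN comparison inequality.  For geodesic spaces this is the standard comparison
formulation of the CAT(0) condition, which (by the Cartan–Hadamard theorem and Gromov's link
condition) is equivalent to: connected, simply connected, and no metric link contains a
locally geodesic loop of length less than `2 * π`. -/
def SC.IsCAT0 (K : SC V) : Prop :=
  K.faces.Nonempty ∧
  (∀ x y, K.IsPoint x → K.IsPoint y →
    ∃ c, K.IsChain c ∧ c.head? = some x ∧ c.getLast? = some y) ∧
  (∀ x y, K.IsPoint x → K.IsPoint y →
    ∃ m, K.IsPoint m ∧ K.pdist x m = K.pdist x y / 2 ∧ K.pdist m y = K.pdist x y / 2) ∧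
  (∀ x y z m, K.IsPoint x → K.IsPoint y → K.IsPoint z → K.IsPoint m →
    K.pdist y m = K.pdist y z / 2 → K.pdist m z = K.pdist y z / 2 →
    K.pdist x m ^ 2 ≤ K.pdist x y ^ 2 / 2 + K.pdist x z ^ 2 / 2 - K.pdist y z ^ 2 / 4)

/-- Adjacency of vertices in the 1-skeleton of `K`. -/
def SC.adj (K : SC V) (u v : V) : Prop := u ≠ v ∧ ({u, v} : Finset V) ∈ K.faces

/-! ## Combinatorial paths -/

/-- A combinatorial edge path with respect to an adjacency relation `E`: an eventually
constant function `ℕ → V` traversing an edge at each time `i < len`.  (Equivalently, an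
alternating sequence `[v₀, e₁, v₁, …, e_n, v_n]` of vertices and edges with `eᵢ` spanned by
`{v_{i-1}, v_i}`; its parameterization is constant after time `len`.) -/
structure EPath {V : Type*} (E : V → V → Prop) where
  f : ℕ → V
  len : ℕ
  step : ∀ i, i < len → E (f i) (f (i + 1))
  stable : ∀ i, len ≤ i → f i = f len

namespace EPath

variable {E : V → V → Prop}

/-- The starting vertex. -/
def src (p : EPath E) : V := p.f 0

/-- The ending vertex. -/
def dst (p : EPath E) : V := p.f p.len

/-- A combinatorial loop. -/
def Closed (p : EPath E) : Prop := p.dst = p.src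

/-- A path is tight if it does not cross the same (unordered) edge twice. -/
def Tight (p : EPath E) : Prop :=
  ∀ i j, i < p.len → j < p.len →
    ({p.f i, p.f (i + 1)} : Finset V) = ({p.f j, p.f (j + 1)} : Finset V) → i = j

/-- The word of vertices read by a path. -/
def word (p : EPath E) : List V := (List.range (p.len + 1)).map p.f

end EPath

/-- The combinatorial distance between two vertices: the least length of an edge path. -/
def SC.cd (K : SC V) (u v : V) : ℕ :=
  sInf {n | ∃ p : EPath K.adj, p.src = u ∧ p.dst = v ∧ p.len = n}

/-- A combinatorial geodesic: a path of minimal length between its endpoints. -/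
def SC.IsGeo (K : SC V) (p : EPath K.adj) : Prop := p.len = K.cd p.src p.dst

/-! ## Basic moves on combinatorial paths -/

/-- A trivial move: delete a backtracking subpath `a, b, a`, replacing it by `a`. -/
def TrivMove (K : SC V) (p q : EPath K.adj) : Prop :=
  ∃ i, i + 2 ≤ p.len ∧ p.f (i + 2) = p.f i ∧ q.len + 2 = p.len ∧
    (∀ j, j ≤ i → q.f j = p.f j) ∧ ∀ j, i ≤ j → j ≤ q.len → q.f j = p.f (j + 2)

/-- A triangle move: replace two sides `a, b, c` of a triangle of `K` by the third side `a, c`. -/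
def TriMove (K : SC V) (p q : EPath K.adj) : Prop :=
  ∃ i, i + 2 ≤ p.len ∧
    ({p.f i, p.f (i + 1), p.f (i + 2)} : Finset V) ∈ K.faces ∧
    ({p.f i, p.f (i + 1), p.f (i + 2)} : Finset V).card = 3 ∧
    q.len + 1 = p.len ∧
    (∀ j, j ≤ i → q.f j = p.f j) ∧ ∀ j, i < j → j ≤ q.len → q.f j = p.f (j + 1)

/-- A triangle-triangle move: across two triangles `{a, b, x}` and `{b, x, c}` of `K` sharing
the edge `{b, x}`, replace the arc `a, b, c` by the arc `a, x, c` (where `a, c` are the two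
opposite degree-two vertices of the doubly based disk). -/
def TTMove (K : SC V) (p q : EPath K.adj) : Prop :=
  ∃ i x, 0 < i ∧ i < p.len ∧ q.len = p.len ∧ q.f i = x ∧ (∀ j, j ≠ i → q.f j = p.f j) ∧
    x ≠ p.f i ∧ p.f (i - 1) ≠ p.f (i + 1) ∧
    ({p.f (i - 1), p.f i, x} : Finset V) ∈ K.faces ∧
    ({p.f (i - 1), p.f i, x} : Finset V).card = 3 ∧
    ({p.f i, x, p.f (i + 1)} : Finset V) ∈ K.faces ∧
    ({p.f i, x, p.f (i + 1)} : Finset V).card = 3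

/-- A basic move: a trivial move, a triangle move, or a triangle-triangle move.  Trivial and
triangle moves are length-reducing; triangle-triangle moves are length-preserving. -/
def BasicMove (K : SC V) (p q : EPath K.adj) : Prop :=
  TrivMove K p q ∨ TriMove K p q ∨ TTMove K p q

/-! ## Disk diagrams -/

/-- Points of the Euclidean plane. -/
abbrev Pt2 : Type := ℝ × ℝ

/-- A simplicial disk diagram: a finite 2-complex embedded in the Euclidean plane `ℝ²`
(vertices are points, edges are straight segments, 2-cells are nondegenerate triangles, and
any two cells meet in the realization of their common face), whose support (the union of its
cells) is contractible. -/
structure SimpDisk where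
  verts : Finset Pt2
  edges : Finset (Finset Pt2)
  facesD : Finset (Finset Pt2)
  verts_nonempty : verts.Nonempty
  edge_card : ∀ e ∈ edges, e.card = 2
  edge_sub : ∀ e ∈ edges, e ⊆ verts
  face_card : ∀ t ∈ facesD, t.card = 3
  face_sub : ∀ t ∈ facesD, t ⊆ verts
  face_edges : ∀ t ∈ facesD, ∀ e : Finset Pt2, e ⊆ t → e.card = 2 → e ∈ edges
  face_nondegen : ∀ t ∈ facesD, ¬ Collinear ℝ (t : Set Pt2)
  glue : ∀ s ∈ verts.image (fun v => ({v} : Finset Pt2)) ∪ edges ∪ facesD,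
         ∀ t ∈ verts.image (fun v => ({v} : Finset Pt2)) ∪ edges ∪ facesD,
      convexHull ℝ (s : Set Pt2) ∩ convexHull ℝ (t : Set Pt2) =
        convexHull ℝ ((s ∩ t : Finset Pt2) : Set Pt2)
  contractible : ContractibleSpace
    (⋃ s ∈ (verts.image (fun v => ({v} : Finset Pt2)) ∪ edges ∪ facesD : Finset (Finset Pt2)),
      convexHull ℝ (s : Set Pt2))

namespace SimpDisk

/-- The cells of a disk diagram. -/
def cells (D : SimpDisk) : Finset (Finset Pt2) :=
  D.verts.image (fun v => ({v} : Finset Pt2)) ∪ D.edges ∪ D.facesD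

/-- The support of a disk diagram: the union of its closed cells in the plane. -/
def supp (D : SimpDisk) : Set Pt2 := ⋃ s ∈ D.cells, convexHull ℝ (s : Set Pt2)

/-- A disk diagram is nonsingular if it is homeomorphic to the closed unit disk;
otherwise it is singular (it has a cut point). -/
def Nonsingular (D : SimpDisk) : Prop :=
  Nonempty (D.supp ≃ₜ (Metric.closedBall (0 : Pt2) 1 : Set Pt2))

/-- The degree of a vertex: the number of edges of `D` incident to it. -/
def deg (D : SimpDisk) (v : Pt2) : ℕ := (D.edges.filter fun e => v ∈ e).card

/-- A boundary vertex of a disk diagram. -/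
def BVert (D : SimpDisk) (v : Pt2) : Prop := v ∈ D.verts ∧ v ∈ frontier D.supp

/-- An interior vertex of a disk diagram. -/
def IVert (D : SimpDisk) (v : Pt2) : Prop := v ∈ D.verts ∧ v ∈ interior D.supp

/-- A boundary edge of a disk diagram. -/
def BEdge (D : SimpDisk) (e : Finset Pt2) : Prop :=
  e ∈ D.edges ∧ convexHull ℝ (e : Set Pt2) ⊆ frontier D.supp

/-- Adjacency in the 1-skeleton of a disk diagram. -/
def adj (D : SimpDisk) (a b : Pt2) : Prop := a ≠ b ∧ ({a, b} : Finset Pt2) ∈ D.edges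

/-- The combinatorial area of a simplicial disk: the number of its triangles. -/
def area (D : SimpDisk) : ℕ := D.facesD.card

/-- The boundary cycle of a disk diagram: a closed edge path traversing exactly the
boundary edges of `D`. -/
def IsBoundaryCycle (D : SimpDisk) (c : EPath D.adj) : Prop :=
  c.Closed ∧ (∀ i, i < c.len → D.BEdge {c.f i, c.f (i + 1)}) ∧
  (∀ e : Finset Pt2, D.BEdge e → ∃ i, i < c.len ∧ e = {c.f i, c.f (i + 1)}) ∧
  (∀ v, D.BVert v → ∃ i, i ≤ c.len ∧ c.f i = v)

end SimpDisk

/-- A disk diagram spanning the combinatorial loop `α` in the complex `K`: a simplicial disk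
`D` together with a simplicial map `D → K` whose restriction to the boundary cycle of `D`
is `α`. -/
structure SpanningDisk (K : SC V) (α : EPath K.adj) where
  D : SimpDisk
  fmap : Pt2 → V
  cellmap : ∀ s ∈ D.cells, s.image fmap ∈ K.faces
  bc : EPath D.adj
  bc_is : D.IsBoundaryCycle bc
  bc_len : bc.len = α.len
  bc_map : ∀ i, fmap (bc.f i) = α.f i

/-- A spanning disk of minimal combinatorial area among the disks spanning the same loop. -/
def SpanningDisk.IsMinimal {K : SC V} {α : EPath K.adj} (S : SpanningDisk K α) : Prop :=
  ∀ S' : SpanningDisk K α, S.D.area ≤ S'.D.area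

/-- An empty `n`-gon: a tight combinatorial loop of length `n` all of whose minimal spanning
disks have an interior vertex. -/
def SC.IsEmptyNgon (K : SC V) (α : EPath K.adj) (n : ℕ) : Prop :=
  α.Closed ∧ α.Tight ∧ α.len = n ∧
  ∀ S : SpanningDisk K α, S.IsMinimal → ∃ v : Pt2, S.D.IVert v

/-! ## Flagness, fullness, links -/

/-- A complex is flag if every nonempty finite set of vertices pairwise joined by edges
spans a simplex. -/
def SC.IsFlag (K : SC V) : Prop :=
  ∀ s : Finset V, s.Nonempty → (∀ v ∈ s, ({v} : Finset V) ∈ K.faces) →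
    (∀ u ∈ s, ∀ w ∈ s, u ≠ w → ({u, w} : Finset V) ∈ K.faces) → s ∈ K.faces

/-- `L` is a full subcomplex of `K`: a subcomplex containing every simplex of `K` whose
vertices all lie in `L`. -/
def SC.FullIn (L K : SC V) : Prop :=
  L.faces ⊆ K.faces ∧ ∀ s ∈ K.faces, (∀ v ∈ s, ({v} : Finset V) ∈ L.faces) → s ∈ L.faces

/-- The (metric) link of a vertex `v` of `K`, described combinatorially: its simplices
correspond to the simplices `t` of `K` with `insert v t` a simplex of `K` (a vertex of the
link corresponds to an edge of `K` incident to `v`, i.e. to its unit tangent direction). -/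
def SC.link (K : SC V) (v : V) : SC V where
  faces := {t | t ∈ K.faces ∧ v ∉ t ∧ insert v t ∈ K.faces}
  not_mem_empty := fun h => K.not_mem_empty h.1
  down := by
    rintro s ⟨hs, hvs, hins⟩ t hts htne
    refine ⟨K.down s hs t hts htne, fun hvt => hvs (hts hvt), ?_⟩
    refine K.down _ hins _ (Finset.insert_subset_insert v hts) ?_
    simp

/-- The combinatorial link of a simplex `σ` of `K`: the union of all simplices `t` such that
`t ∗ σ = t ∪ σ` is a simplex of `K`. -/
def SC.clink (K : SC V) (σ : Finset V) : SC V where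
  faces := {t | t ∈ K.faces ∧ Disjoint t σ ∧ t ∪ σ ∈ K.faces}
  not_mem_empty := fun h => K.not_mem_empty h.1
  down := by
    rintro s ⟨hs, hdisj, huni⟩ t hts htne
    refine ⟨K.down s hs t hts htne, hdisj.mono_left hts, ?_⟩
    refine K.down _ huni _ (Finset.union_subset_union hts (subset_refl σ)) ?_
    intro h
    exact htne (Finset.union_eq_empty.mp h).1

/-- A complex is `k`-large if it is flag and contains no empty `n`-gons for `n < k`. -/
def SC.IsKLarge (K : SC V) (k : ℕ) : Prop :=
  K.IsFlag ∧ ∀ (α : EPath K.adj) (n : ℕ), n < k → ¬ K.IsEmptyNgon α n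

/-- A complex is systolic (satisfies simplicial nonpositive curvature) if the combinatorial
link of every simplex is 6-large. -/
def SC.IsSystolic (K : SC V) : Prop := ∀ σ ∈ K.faces, (K.clink σ).IsKLarge 6

/-! ## Gersten–Short geodesics -/

/-- The diagonal condition for a path lifted along the boundary of a disk `D` via `c` at
offset `o`, of length `n`: whenever the `j`-th vertex is positive (`4 - deg > 0`), the
`(j-1)`-st vertex is negative (`4 - deg < 0`), for `1 ≤ j ≤ n - 1`. -/
def DiagCondAt (D : SimpDisk) (c : ℕ → Pt2) (o n : ℕ) : Prop :=
  ∀ j, 0 < j → j < n → D.deg (c (o + j)) < 4 → 4 < D.deg (c (o + j - 1))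

/-- A Gersten–Short geodesic: a combinatorial geodesic satisfying the diagonal condition
along every minimal (possibly singular) spanning disk having it along its boundary. -/
def IsGS (K : SC V) (γ : EPath K.adj) : Prop :=
  K.IsGeo γ ∧
  ∀ (β : EPath K.adj), β.Closed →
    ∀ S : SpanningDisk K β, S.IsMinimal →
      ∀ o : ℕ, o + γ.len ≤ S.bc.len →
        (∀ j, j ≤ γ.len → S.fmap (S.bc.f (o + j)) = γ.f j) →
          DiagCondAt S.D S.bc.f o γ.len

/-! ## Finite state automata and regular path systems -/

/-- A finite state automaton over the alphabet `A`: a finite labeled directed graph with a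
distinguished start vertex and a set of accept vertices. -/
structure FSA (A : Type*) where
  n : ℕ
  start : Fin n
  accept : Finset (Fin n)
  trans : Set (Fin n × A × Fin n)
  trans_finite : trans.Finite

/-- A word is accepted by an FSA if it labels a directed path from the start vertex to an
accept vertex. -/
def FSA.Accepts {A : Type*} (M : FSA A) (w : List A) : Prop :=
  ∃ q : ℕ → Fin M.n, q 0 = M.start ∧ q w.length ∈ M.accept ∧
    ∀ (i : ℕ) (h : i < w.length), (q i, w.get ⟨i, h⟩, q (i + 1)) ∈ M.trans

/-- A path system is regular if the set of its vertex words is the language accepted by some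
finite state automaton. -/
def RegularSystem {E : V → V → Prop} (P : Set (EPath E)) : Prop :=
  ∃ M : FSA V, ∀ w : List V, M.Accepts w ↔ ∃ p ∈ P, p.word = w

/-- `U` is the union of the disk diagrams `D1` and `D2` glued exactly along the combinatorial
path read by `c1` (resp. `c2`) at offset `o1` (resp. `o2`) for `n` steps. -/
def IsUnionAlong (U D1 D2 : SimpDisk) (c1 c2 : ℕ → Pt2) (o1 o2 n : ℕ) : Prop :=
  U.verts = D1.verts ∪ D2.verts ∧
  U.edges = D1.edges ∪ D2.edges ∧
  U.facesD = D1.facesD ∪ D2.facesD ∧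
  (∀ j, j ≤ n → c1 (o1 + j) = c2 (o2 + j)) ∧
  D1.verts ∩ D2.verts = (Finset.range (n + 1)).image (fun j => c1 (o1 + j)) ∧
  D1.edges ∩ D2.edges =
    (Finset.range n).image (fun j => ({c1 (o1 + j), c1 (o1 + j + 1)} : Finset Pt2)) ∧
  D1.facesD ∩ D2.facesD = ∅

end

/-! ### Planar geometry -/

/-- The oriented area form. -/
def cr (a b x : Pt2) : ℝ := (b.1 - a.1) * (x.2 - a.2) - (b.2 - a.2) * (x.1 - a.1)

lemma cr_cont (a b : Pt2) : Continuous (cr a b) := by unfold cr; fun_prop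

lemma cr_comb (a b x y : Pt2) (s t : ℝ) (h : s + t = 1) :
    cr a b (s • x + t • y) = s * cr a b x + t * cr a b y := by
  have : t = 1 - s := by linarith
  subst this
  simp only [cr, Prod.fst_add, Prod.snd_add, Prod.smul_fst, Prod.smul_snd, smul_eq_mul]
  ring

lemma hull_cr_nonneg {a b : Pt2} {s : Set Pt2} (h : ∀ p ∈ s, 0 ≤ cr a b p) {x : Pt2}
    (hx : x ∈ convexHull ℝ s) : 0 ≤ cr a b x := by
  have hc : Convex ℝ {x | 0 ≤ cr a b x} := by
    intro x hx y hy s t hs ht hst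
    simp only [Set.mem_ofPred_eq] at *
    rw [cr_comb _ _ _ _ _ _ hst]
    positivity
  exact convexHull_min (s := s) (t := {x | 0 ≤ cr a b x}) h hc hx

lemma hull_cr_nonpos {a b : Pt2} {s : Set Pt2} (h : ∀ p ∈ s, cr a b p ≤ 0) {x : Pt2}
    (hx : x ∈ convexHull ℝ s) : cr a b x ≤ 0 := by
  have e : ∀ p, cr b a p = - cr a b p := by intro p; unfold cr; ring
  have := hull_cr_nonneg (a := b) (b := a) (s := s) (fun p hp => by rw [e]; linarith [h p hp]) hx
  rw [e] at this; linarith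

lemma cr_left (a b : Pt2) : cr a b a = 0 := by unfold cr; ring
lemma cr_right (a b : Pt2) : cr a b b = 0 := by unfold cr; ring
lemma cr_swap (a b p : Pt2) : cr b a p = - cr a b p := by unfold cr; ring
lemma cr_rot (a b p : Pt2) : cr b p a = cr a b p := by unfold cr; ring
lemma cr_rot' (a b p : Pt2) : cr p a b = cr a b p := by unfold cr; ring

lemma hull_pair_cr {a b x : Pt2} (hx : x ∈ convexHull ℝ ({a, b} : Set Pt2)) : cr a b x = 0 := by
  apply le_antisymm
  · apply hull_cr_nonpos _ hx
    rintro p (rfl | rfl)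
    · rw [cr_left]
    · rw [cr_right]
  · apply hull_cr_nonneg _ hx
    rintro p (rfl | rfl)
    · rw [cr_left]
    · rw [cr_right]

lemma tri_mem {a b c x : Pt2} (h : 0 < cr a b c) (h1 : 0 ≤ cr a b x) (h2 : 0 ≤ cr b c x)
    (h3 : 0 ≤ cr c a x) : x ∈ convexHull ℝ ({a, b, c} : Set Pt2) := by
  have key : ∑ i : Fin 3, (![cr b c x / cr a b c, cr c a x / cr a b c, cr a b x / cr a b c] i) •
      (![a, b, c] i) ∈ convexHull ℝ ({a, b, c} : Set Pt2) := by
    apply (convex_convexHull ℝ _).sum_mem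
    · intro i _; fin_cases i <;> simp <;> positivity
    · simp [Fin.sum_univ_three]
      field_simp
      unfold cr; ring
    · intro i _; apply subset_convexHull; fin_cases i <;> simp
  convert key using 1
  have h' := h.ne'
  ext <;> simp [Fin.sum_univ_three] <;> field_simp <;> unfold cr <;> ring

lemma tri_nonneg {a b c x : Pt2} (h : 0 < cr a b c)
    (hx : x ∈ convexHull ℝ ({a, b, c} : Set Pt2)) :
    0 ≤ cr a b x ∧ 0 ≤ cr b c x ∧ 0 ≤ cr c a x := by
  refine ⟨hull_cr_nonneg ?_ hx, hull_cr_nonneg ?_ hx, hull_cr_nonneg ?_ hx⟩ <;>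
  · simp only [Set.mem_insert_iff, Set.mem_singleton_iff, forall_eq_or_imp, forall_eq]
    simp only [cr_left, cr_right, cr_rot, le_refl, h.le, and_self]

/-- a point of a triangle with one vanishing coordinate is on an edge -/
lemma tri_edge {a b c x : Pt2} (h : 0 < cr a b c)
    (hx : x ∈ convexHull ℝ ({a, b, c} : Set Pt2)) (h0 : cr a b x = 0) :
    x ∈ convexHull ℝ ({a, b} : Set Pt2) := by
  obtain ⟨h1, h2, h3⟩ := tri_nonneg h hx
  rw [convexHull_pair]
  refine ⟨cr b c x / cr a b c, cr c a x / cr a b c, by positivity, by positivity, ?_, ?_⟩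
  · field_simp; unfold cr at *; linarith
  · have h' := h.ne'
    have e : x = (cr b c x / cr a b c) • a + (cr c a x / cr a b c) • b
        + (cr a b x / cr a b c) • c := by
      ext <;> simp <;> field_simp <;> unfold cr <;> ring
    rw [h0] at e
    conv_rhs => rw [e]
    simp

lemma tri_cases {a b c x : Pt2} (h : 0 < cr a b c)
    (hx : x ∈ convexHull ℝ ({a, b, c} : Set Pt2)) :
    x ∈ interior (convexHull ℝ ({a, b, c} : Set Pt2)) ∨ x ∈ convexHull ℝ ({a, b} : Set Pt2) ∨
      x ∈ convexHull ℝ ({b, c} : Set Pt2) ∨ x ∈ convexHull ℝ ({c, a} : Set Pt2) := by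
  obtain ⟨h1, h2, h3⟩ := tri_nonneg h hx
  rcases h1.eq_or_lt with h1 | h1
  · exact Or.inr (Or.inl (tri_edge h hx h1.symm))
  rcases h2.eq_or_lt with h2 | h2
  · refine Or.inr (Or.inr (Or.inl (tri_edge (c := a) (by rwa [cr_rot]) ?_ h2.symm)))
    convert hx using 2; ext; simp; tauto
  rcases h3.eq_or_lt with h3 | h3
  · refine Or.inr (Or.inr (Or.inr (tri_edge (c := b) (by rwa [cr_rot']) ?_ h3.symm)))
    convert hx using 2; ext; simp; tauto
  left
  rw [mem_interior]
  refine ⟨{x | 0 < cr a b x} ∩ {x | 0 < cr b c x} ∩ {x | 0 < cr c a x}, ?_, ?_, ⟨⟨h1, h2⟩, h3⟩⟩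
  · rintro y ⟨⟨h1, h2⟩, h3⟩
    exact tri_mem h h1.le h2.le h3.le
  · exact ((isOpen_lt continuous_const (cr_cont _ _)).inter
      (isOpen_lt continuous_const (cr_cont _ _))).inter
      (isOpen_lt continuous_const (cr_cont _ _))

lemma not_collinear_cr {a b c : Pt2} (hab : a ≠ b) (h : ¬ Collinear ℝ ({a, b, c} : Set Pt2)) :
    cr a b c ≠ 0 := by
  intro h0
  apply h
  rw [collinear_iff_of_mem (p₀ := a) (by simp)]
  refine ⟨b - a, ?_⟩
  have hne : (b.1 - a.1)^2 + (b.2 - a.2)^2 ≠ 0 := by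
    intro h
    apply hab
    have h1 : b.1 - a.1 = 0 := by nlinarith [sq_nonneg (b.1 - a.1), sq_nonneg (b.2 - a.2)]
    have h2 : b.2 - a.2 = 0 := by nlinarith [sq_nonneg (b.1 - a.1), sq_nonneg (b.2 - a.2)]
    ext <;> linarith
  intro p hp
  have hp0 : cr a b p = 0 := by
    rcases hp with rfl | rfl | rfl
    · exact cr_left _ _
    · exact cr_right _ _
    · exact h0
  refine ⟨((p.1 - a.1) * (b.1 - a.1) + (p.2 - a.2) * (b.2 - a.2)) /
    ((b.1 - a.1)^2 + (b.2 - a.2)^2), ?_⟩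
  unfold cr at hp0
  ext
  · simp; field_simp; linear_combination -(b.2 - a.2) * hp0
  · simp; field_simp; linear_combination (b.1 - a.1) * hp0

/-- open segment points are strictly on the inner side of the other two edges -/
lemma seg_pos {a b p m : Pt2} (h : 0 < cr a b p) (hm : m ∈ openSegment ℝ a b) :
    0 < cr b p m ∧ 0 < cr p a m := by
  obtain ⟨s, t, hs, ht, hst, rfl⟩ := hm
  rw [cr_comb _ _ _ _ _ _ hst, cr_comb _ _ _ _ _ _ hst, cr_rot a b p, cr_rot' a b p,
    cr_left, cr_right]
  have := mul_pos hs h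
  have := mul_pos ht h
  constructor <;> linarith

/-- two triangles on the same side of an edge overlap off the edge -/
lemma same_side {a b p q : Pt2} (hp : 0 < cr a b p) (hq : 0 < cr a b q) :
    ∃ y, 0 < cr a b y ∧ y ∈ convexHull ℝ ({a, b, p} : Set Pt2) ∧
      y ∈ convexHull ℝ ({a, b, q} : Set Pt2) := by
  have hm : midpoint ℝ a b ∈ openSegment ℝ a b :=
    ⟨1/2, 1/2, by norm_num, by norm_num, by norm_num, by
      rw [midpoint_eq_smul_add]; simp⟩
  set m := midpoint ℝ a b
  have h1 := seg_pos hp hm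
  have h2 := seg_pos hq hm
  have hm0 : cr a b m = 0 := hull_pair_cr (by
    rw [convexHull_pair]; exact openSegment_subset_segment _ _ _ hm)
  let g : ℝ → Pt2 := fun t => (1 - t) • m + t • p
  have hg : Continuous g := by fun_prop
  have g0 : g 0 = m := by simp [g]
  have ev : ∀ c d : Pt2, 0 < cr c d m → ∀ᶠ t in nhdsWithin (0:ℝ) (Set.Ioi 0), 0 < cr c d (g t) := by
    intro c d h
    apply nhdsWithin_le_nhds
    apply ((cr_cont c d).comp hg).continuousAt.eventually_const_lt
    simpa [g0] using h
  obtain ⟨t, ⟨⟨⟨⟨e1, e2⟩, e3⟩, e4⟩, ht⟩⟩ := ((((ev _ _ h1.1).and (ev _ _ h1.2)).and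
    (ev _ _ h2.1)).and (ev _ _ h2.2)).and self_mem_nhdsWithin |>.exists
  have ht : 0 < t := ht
  have hpos : 0 < cr a b (g t) := by
    simp only [g]
    rw [cr_comb _ _ _ _ _ _ (by ring), hm0]
    simp; positivity
  exact ⟨g t, hpos, tri_mem hp hpos.le e1.le e2.le, tri_mem hq hpos.le e3.le e4.le⟩

/-- two triangles on opposite sides of an edge cover a neighbourhood of the open edge -/
lemma opp_side {a b p q m : Pt2} (hp : 0 < cr a b p) (hq : cr a b q < 0)
    (hm : m ∈ openSegment ℝ a b) :
    m ∈ interior (convexHull ℝ ({a, b, p} : Set Pt2) ∪ convexHull ℝ ({a, b, q} : Set Pt2)) := by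
  have hq' : 0 < cr b a q := by rw [cr_swap]; linarith
  have h1 := seg_pos hp hm
  have h2 := seg_pos hq' (by rwa [openSegment_symm])
  rw [mem_interior]
  refine ⟨{x | 0 < cr b p x} ∩ {x | 0 < cr p a x} ∩ ({x | 0 < cr a q x} ∩ {x | 0 < cr q b x}),
    ?_, ?_, ⟨h1, h2⟩⟩
  · rintro y ⟨⟨e1, e2⟩, ⟨e3, e4⟩⟩
    by_cases h : 0 ≤ cr a b y
    · exact Or.inl (tri_mem hp h e1.le e2.le)
    · right
      have := tri_mem hq' (x := y) (by rw [cr_swap]; linarith) (le_of_lt e3) (le_of_lt e4)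
      convert this using 2; ext; simp; tauto
  · exact ((isOpen_lt continuous_const (cr_cont _ _)).inter
      (isOpen_lt continuous_const (cr_cont _ _))).inter
      ((isOpen_lt continuous_const (cr_cont _ _)).inter
      (isOpen_lt continuous_const (cr_cont _ _)))

/-- a point on a line is not interior to a half plane of that line -/
lemma not_interior_half {a b m : Pt2} (hab : a ≠ b) (hm : cr a b m = 0) {S : Set Pt2}
    (hS : S ⊆ {x | 0 ≤ cr a b x}) : S ∉ nhds m := by
  intro h
  let g : ℝ → Pt2 := fun t => m + t • ((b.2 - a.2, -(b.1 - a.1)) : Pt2)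
  have hg : Continuous g := by fun_prop
  have g0 : g 0 = m := by simp [g]
  have : ∀ᶠ t in nhdsWithin (0:ℝ) (Set.Ioi 0), g t ∈ S := by
    apply nhdsWithin_le_nhds
    apply hg.continuousAt.eventually_mem
    rwa [g0]
  obtain ⟨t, ht, ht0⟩ := (this.and self_mem_nhdsWithin).exists
  have ht0 : 0 < t := ht0
  have h1 := hS ht
  have hne : 0 < (b.1 - a.1)^2 + (b.2 - a.2)^2 := by
    by_contra h
    apply hab
    have h1 : b.1 - a.1 = 0 := by nlinarith [sq_nonneg (b.1 - a.1), sq_nonneg (b.2 - a.2)]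
    have h2 : b.2 - a.2 = 0 := by nlinarith [sq_nonneg (b.1 - a.1), sq_nonneg (b.2 - a.2)]
    ext <;> linarith
  have h2 : cr a b (g t) = cr a b m - t * ((b.1 - a.1)^2 + (b.2 - a.2)^2) := by
    simp [g, cr]; ring
  simp only [Set.mem_ofPred_eq] at h1
  rw [h2, hm] at h1
  have := mul_pos ht0 hne
  linarith


/-! ### Local structure of disk diagrams -/

lemma sd_edge_cell (D : SimpDisk) {e : Finset Pt2} (h : e ∈ D.edges) : e ∈ D.cells := by
  simp [SimpDisk.cells, h]

lemma sd_face_cell (D : SimpDisk) {e : Finset Pt2} (h : e ∈ D.facesD) : e ∈ D.cells := by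
  simp [SimpDisk.cells, h]

lemma sd_vert_cell (D : SimpDisk) {v : Pt2} (h : v ∈ D.verts) : ({v} : Finset Pt2) ∈ D.cells := by
  simp [SimpDisk.cells, h]

lemma sd_hull_sub (D : SimpDisk) {s : Finset Pt2} (h : s ∈ D.cells) :
    convexHull ℝ (s : Set Pt2) ⊆ D.supp := by
  intro x hx
  exact Set.mem_biUnion h hx

lemma sd_mem_supp (D : SimpDisk) {x : Pt2} :
    x ∈ D.supp ↔ ∃ s ∈ D.cells, x ∈ convexHull ℝ (s : Set Pt2) := by
  simp [SimpDisk.supp]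

lemma sd_closed (D : SimpDisk) : IsClosed D.supp := by
  apply Set.Finite.isClosed_biUnion (Finset.finite_toSet _)
  intro s _
  exact (Finset.finite_toSet s).isClosed_convexHull ℝ

lemma sd_local (D : SimpDisk) (x : Pt2) :
    ∀ᶠ y in nhds x, ∀ s ∈ D.cells, y ∈ convexHull ℝ (s : Set Pt2) →
      x ∈ convexHull ℝ (s : Set Pt2) := by
  rw [Filter.eventually_all_finset]
  intro s _
  by_cases h : x ∈ convexHull ℝ (s : Set Pt2)
  · exact Filter.Eventually.of_forall fun _ _ => h
  · have hc : IsClosed (convexHull ℝ (s : Set Pt2)) :=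
      (Finset.finite_toSet s).isClosed_convexHull ℝ
    filter_upwards [hc.isOpen_compl.mem_nhds h] with y hy hy'
    exact absurd hy' hy

lemma sd_vert_mem (D : SimpDisk) {v : Pt2} (hv : v ∈ D.verts) {s : Finset Pt2} (hs : s ∈ D.cells)
    (h : v ∈ convexHull ℝ (s : Set Pt2)) : v ∈ s := by
  have := D.glue s hs {v} (sd_vert_cell D hv)
  have h2 : v ∈ convexHull ℝ (s : Set Pt2) ∩ convexHull ℝ (({v} : Finset Pt2) : Set Pt2) :=
    ⟨h, by simp⟩
  rw [this] at h2
  by_contra hvs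
  rw [Finset.inter_singleton_of_notMem hvs] at h2
  simp at h2

lemma sd_edge_mem (D : SimpDisk) {a b m : Pt2} (hab : a ≠ b) (he : ({a, b} : Finset Pt2) ∈ D.edges)
    (hm : m ∈ openSegment ℝ a b) {s : Finset Pt2} (hs : s ∈ D.cells)
    (h : m ∈ convexHull ℝ (s : Set Pt2)) : ({a, b} : Finset Pt2) ⊆ s := by
  have := D.glue s hs _ (sd_edge_cell D he)
  have h2 : m ∈ convexHull ℝ (s : Set Pt2) ∩ convexHull ℝ (({a, b} : Finset Pt2) : Set Pt2) :=
    ⟨h, by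
      rw [Finset.coe_pair, convexHull_pair]; exact openSegment_subset_segment _ _ _ hm⟩
  rw [this] at h2
  have ha : a ∈ s := by
    by_contra ha
    have : ((s ∩ {a, b} : Finset Pt2) : Set Pt2) ⊆ {b} := by
      intro x hx
      simp only [Finset.coe_inter, Finset.coe_pair, Set.mem_inter_iff, Finset.mem_coe,
        Set.mem_insert_iff, Set.mem_singleton_iff] at hx
      rcases hx with ⟨h1, rfl | rfl⟩
      · exact absurd h1 ha
      · rfl
    have h3 := convexHull_mono (𝕜 := ℝ) this h2
    simp only [convexHull_singleton, Set.mem_singleton_iff] at h3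
    subst h3
    exact hab (right_mem_openSegment_iff.1 hm)
  have hb : b ∈ s := by
    by_contra hb
    have : ((s ∩ {a, b} : Finset Pt2) : Set Pt2) ⊆ {a} := by
      intro x hx
      simp only [Finset.coe_inter, Finset.coe_pair, Set.mem_inter_iff, Finset.mem_coe,
        Set.mem_insert_iff, Set.mem_singleton_iff] at hx
      rcases hx with ⟨h1, rfl | rfl⟩
      · rfl
      · exact absurd h1 hb
    have h3 := convexHull_mono (𝕜 := ℝ) this h2
    simp only [convexHull_singleton, Set.mem_singleton_iff] at h3
    subst h3
    exact hab (left_mem_openSegment_iff.1 hm)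
  intro x hx
  simp only [Finset.mem_insert, Finset.mem_singleton] at hx
  rcases hx with rfl | rfl <;> assumption

/-- the faces containing an edge -/
noncomputable def fcs (D : SimpDisk) (e : Finset Pt2) : Finset (Finset Pt2) :=
  D.facesD.filter (fun t => e ⊆ t)

lemma sd_third (D : SimpDisk) {a b : Pt2} (hab : a ≠ b) {t : Finset Pt2} (ht : t ∈ D.facesD)
    (h : ({a, b} : Finset Pt2) ⊆ t) : ∃ p, t = {a, b, p} ∧ cr a b p ≠ 0 := by
  have h3 := D.face_card t ht
  have h1 : (t \ {a, b}).card = 1 := by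
    rw [Finset.card_sdiff_of_subset h, h3, Finset.card_pair hab]
  obtain ⟨p, hp⟩ := Finset.card_eq_one.1 h1
  have e : t = {a, b, p} := by
    rw [← Finset.sdiff_union_of_subset h, hp]
    ext; simp; tauto
  refine ⟨p, e, not_collinear_cr hab ?_⟩
  have := D.face_nondegen t ht
  rw [e] at this
  simpa using this

lemma sd_same_pos (D : SimpDisk) {a b p q : Pt2} (hab : a ≠ b)
    (hp : ({a, b, p} : Finset Pt2) ∈ D.facesD)
    (hq : ({a, b, q} : Finset Pt2) ∈ D.facesD) (h1 : 0 < cr a b p) (h2 : 0 < cr a b q) :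
    p = q := by
  by_contra hpq
  obtain ⟨y, hy, y1, y2⟩ := same_side h1 h2
  have hg := D.glue _ (sd_face_cell D hp) _ (sd_face_cell D hq)
  have e : ({a, b, p} ∩ {a, b, q} : Finset Pt2) = {a, b} := by
    have hpa : p ≠ a := by rintro rfl; simp [cr_left] at h1
    have hpb : p ≠ b := by rintro rfl; simp [cr_right] at h1
    ext x
    simp only [Finset.mem_inter, Finset.mem_insert, Finset.mem_singleton]
    constructor
    · rintro ⟨rfl | rfl | rfl, h⟩
      · simp
      · simp
      · exact absurd h (by simp [hpa, hpb, hpq])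
    · rintro (rfl | rfl) <;> simp
  rw [e] at hg
  have hy' : y ∈ convexHull ℝ (({a, b} : Finset Pt2) : Set Pt2) := by
    rw [← hg]; exact ⟨by simpa using y1, by simpa using y2⟩
  have := hull_pair_cr (by simpa using hy')
  linarith

lemma sd_same (D : SimpDisk) {a b p q : Pt2} (hab : a ≠ b)
    (hp : ({a, b, p} : Finset Pt2) ∈ D.facesD)
    (hq : ({a, b, q} : Finset Pt2) ∈ D.facesD) (h : 0 < cr a b p * cr a b q) :
    p = q := by
  rcases pos_and_pos_or_neg_and_neg_of_mul_pos h with h | h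
  · exact sd_same_pos D hab hp hq h.1 h.2
  · rw [Finset.insert_comm] at hp hq
    exact sd_same_pos D hab.symm hp hq (by rw [cr_swap]; linarith) (by rw [cr_swap]; linarith)

lemma fcs_le_two (D : SimpDisk) {e : Finset Pt2} (he : e ∈ D.edges) : (fcs D e).card ≤ 2 := by
  by_contra hc
  obtain ⟨a, b, hab, rfl⟩ := Finset.card_eq_two.1 (D.edge_card e he)
  obtain ⟨t1, h1, t2, h2, t3, h3, h12, h13, h23⟩ := Finset.two_lt_card.1 (not_le.1 hc)
  simp only [fcs, Finset.mem_filter] at h1 h2 h3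
  obtain ⟨p, rfl, hp⟩ := sd_third D hab h1.1 h1.2
  obtain ⟨q, rfl, hq⟩ := sd_third D hab h2.1 h2.2
  obtain ⟨r, rfl, hr⟩ := sd_third D hab h3.1 h3.2
  have n1 : ¬ 0 < cr a b p * cr a b q := fun h => h12 (by rw [sd_same D hab h1.1 h2.1 h])
  have n2 : ¬ 0 < cr a b p * cr a b r := fun h => h13 (by rw [sd_same D hab h1.1 h3.1 h])
  have n3 : ¬ 0 < cr a b q * cr a b r := fun h => h23 (by rw [sd_same D hab h2.1 h3.1 h])
  rcases lt_or_gt_of_ne hp with h | h <;> rcases lt_or_gt_of_ne hq with h' | h' <;>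
    rcases lt_or_gt_of_ne hr with h'' | h'' <;>
    first
    | exact n1 (mul_pos h h')
    | exact n2 (mul_pos h h'')
    | exact n3 (mul_pos h' h'')
    | exact n1 (mul_pos_of_neg_of_neg h h')
    | exact n2 (mul_pos_of_neg_of_neg h h'')
    | exact n3 (mul_pos_of_neg_of_neg h' h'')

lemma sd_two_interior (D : SimpDisk) {a b : Pt2} (hab : a ≠ b)
    (h : 1 < (fcs D {a, b}).card) {m : Pt2} (hm : m ∈ openSegment ℝ a b) :
    m ∈ interior D.supp := by
  obtain ⟨t1, h1, t2, h2, h12⟩ := Finset.one_lt_card.1 h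
  simp only [fcs, Finset.mem_filter] at h1 h2
  obtain ⟨p, rfl, hp⟩ := sd_third D hab h1.1 h1.2
  obtain ⟨q, rfl, hq⟩ := sd_third D hab h2.1 h2.2
  have n1 : ¬ 0 < cr a b p * cr a b q := fun h => h12 (by rw [sd_same D hab h1.1 h2.1 h])
  have s1 := sd_hull_sub D (sd_face_cell D h1.1)
  have s2 := sd_hull_sub D (sd_face_cell D h2.1)
  simp only [Finset.coe_insert, Finset.coe_singleton] at s1 s2
  rcases lt_or_gt_of_ne hp with h | h <;> rcases lt_or_gt_of_ne hq with h' | h'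
  · exact absurd (mul_pos_of_neg_of_neg h h') n1
  · exact interior_mono (Set.union_subset s2 s1) (opp_side h' h hm)
  · exact interior_mono (Set.union_subset s1 s2) (opp_side h h' hm)
  · exact absurd (mul_pos h h') n1

lemma sd_mid (a b : Pt2) : midpoint ℝ a b ∈ openSegment ℝ a b :=
    ⟨1/2, 1/2, by norm_num, by norm_num, by norm_num, by
      rw [midpoint_eq_smul_add]; simp⟩

lemma sd_bedge_le (D : SimpDisk) {e : Finset Pt2} (he : D.BEdge e) : (fcs D e).card ≤ 1 := by
  by_contra hc
  obtain ⟨a, b, hab, rfl⟩ := Finset.card_eq_two.1 (D.edge_card e he.1)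
  have h1 := sd_two_interior D hab (not_le.1 hc) (sd_mid a b)
  have h2 : midpoint ℝ a b ∈ frontier D.supp := he.2 (by
    rw [Finset.coe_pair, convexHull_pair]; exact openSegment_subset_segment _ _ _ (sd_mid a b))
  exact h2.2 h1

lemma sd_one_bedge (D : SimpDisk) {e : Finset Pt2} (he : e ∈ D.edges) (h1 : (fcs D e).card = 1) :
    D.BEdge e := by
  refine ⟨he, ?_⟩
  obtain ⟨a, b, hab, rfl⟩ := Finset.card_eq_two.1 (D.edge_card e he)
  obtain ⟨t, ht⟩ := Finset.card_eq_one.1 h1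
  have htm : t ∈ fcs D {a, b} := by rw [ht]; simp
  have htm' := htm
  simp only [fcs, Finset.mem_filter] at htm'
  obtain ⟨p, rfl, hp⟩ := sd_third D hab htm'.1 htm'.2
  have key : ∀ m ∈ openSegment ℝ a b, m ∈ frontier D.supp := by
    intro m hm
    have hm' : m ∈ convexHull ℝ ({a, b} : Set Pt2) := by
      rw [convexHull_pair]; exact openSegment_subset_segment _ _ _ hm
    have hmc : cr a b m = 0 := hull_pair_cr hm'
    rw [(sd_closed D).frontier_eq]
    refine ⟨sd_hull_sub D (sd_edge_cell D he) (by simpa using hm'), ?_⟩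
    intro hi
    have hloc : convexHull ℝ ({a, b, p} : Set Pt2) ∈ nhds m := by
      filter_upwards [sd_local D m, mem_interior_iff_mem_nhds.1 hi] with y hy hyX
      obtain ⟨s, hs, hys⟩ := (sd_mem_supp D).1 hyX
      have hsub := sd_edge_mem D hab he hm hs (hy s hs hys)
      have hs' := hs
      simp only [SimpDisk.cells, Finset.mem_union, Finset.mem_image] at hs'
      rcases hs' with (⟨v, _, rfl⟩ | hs') | hs'
      · have := Finset.card_le_card hsub
        rw [Finset.card_pair hab] at this; simp at this
      · have : s = {a, b} := (Finset.eq_of_subset_of_card_le hsub (by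
          rw [D.edge_card s hs', Finset.card_pair hab])).symm
        subst this
        refine convexHull_mono ?_ hys
        intro x; simp; tauto
      · have : s ∈ fcs D {a, b} := by simp [fcs, hs', hsub]
        rw [ht, Finset.mem_singleton] at this
        subst this
        simpa using hys
    rcases lt_or_gt_of_ne hp with h | h
    · refine not_interior_half (a := b) (b := a) hab.symm (by rw [cr_swap, hmc]; simp) ?_ hloc
      intro y hy
      refine hull_cr_nonneg ?_ hy
      simp [cr_left, cr_right, cr_swap a b, h.le]
    · refine not_interior_half (a := a) (b := b) hab hmc ?_ hloc
      intro y hy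
      exact (tri_nonneg h hy).1
  rw [Finset.coe_pair, convexHull_pair, ← closure_openSegment]
  exact closure_minimal key isClosed_frontier


lemma pt2_rank : 1 < Module.rank ℝ Pt2 := by
  rw [rank_prod', Module.rank_self]; norm_num

/-- A disk has no one-dimensional open subsets. -/
lemma sd_N (D : SimpDisk) (hns : D.Nonsingular) {U : Set Pt2} (hU : IsOpen U) {x : Pt2}
    (hx : x ∈ U) (hxX : x ∈ D.supp) (h : Pt2 → ℝ) (hc : Continuous h)
    (hinj : ∀ y ∈ U, y ∈ D.supp → ∀ z ∈ U, z ∈ D.supp → h y = h z → y = z) : False := by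
  obtain ⟨φ⟩ := hns
  have ho : IsOpen {w : (Metric.closedBall (0 : Pt2) 1 : Set Pt2) | (φ.symm w : Pt2) ∈ U} :=
    hU.preimage (continuous_subtype_val.comp φ.symm.continuous)
  obtain ⟨O, hO, hOe⟩ := isOpen_induced_iff.1 ho
  have hOm : ∀ w (hw : w ∈ Metric.closedBall (0 : Pt2) 1), w ∈ O → (φ.symm ⟨w, hw⟩ : Pt2) ∈ U := by
    intro w hw hwO
    have : (⟨w, hw⟩ : (Metric.closedBall (0 : Pt2) 1 : Set Pt2)) ∈ Subtype.val ⁻¹' O := hwO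
    rw [hOe] at this
    exact this
  have h0 : (φ ⟨x, hxX⟩ : Pt2) ∈ O := by
    have : φ ⟨x, hxX⟩ ∈ {w : (Metric.closedBall (0 : Pt2) 1 : Set Pt2) | (φ.symm w : Pt2) ∈ U} := by
      simpa using hx
    rw [← hOe] at this
    exact this
  have hcl : (φ ⟨x, hxX⟩ : Pt2) ∈ closure (Metric.ball (0 : Pt2) 1) := by
    rw [closure_ball _ one_ne_zero]; exact (φ ⟨x, hxX⟩).2
  obtain ⟨z, hzO, hzb⟩ := mem_closure_iff.1 hcl O hO h0
  obtain ⟨r, hr, hrs⟩ := Metric.nhds_basis_closedBall.mem_iff.1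
    ((hO.inter Metric.isOpen_ball).mem_nhds ⟨hzO, hzb⟩)
  have hS : ∀ w ∈ Metric.sphere z r, w ∈ O ∧ w ∈ Metric.closedBall (0 : Pt2) 1 := by
    intro w hw
    have := hrs (Metric.sphere_subset_closedBall hw)
    exact ⟨this.1, Metric.ball_subset_closedBall this.2⟩
  have hpc : PreconnectedSpace (Metric.sphere z r) :=
    Subtype.preconnectedSpace (isPreconnected_sphere pt2_rank z r)
  let i : Metric.sphere z r → (Metric.closedBall (0 : Pt2) 1 : Set Pt2) :=
    fun w => ⟨w, (hS w w.2).2⟩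
  have hi : Continuous i := by fun_prop
  let g : Metric.sphere z r → ℝ := fun w => h (φ.symm (i w))
  have hg : Continuous g := hc.comp (continuous_subtype_val.comp (φ.symm.continuous.comp hi))
  have hginj : ∀ w w', g w = g w' → w = w' := by
    intro w w' hww
    have := hinj _ (hOm w (hS w w.2).2 (hS w w.2).1) (φ.symm (i w)).2
      _ (hOm w' (hS w' w'.2).2 (hS w' w'.2).1) (φ.symm (i w')).2 hww
    have := φ.symm.injective (Subtype.ext this)
    simp only [Subtype.mk.injEq] at this
    exact Subtype.ext this
  let A : Metric.sphere z r → Metric.sphere z r := fun w => ⟨z + z - w, by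
    have := w.2
    rw [mem_sphere_iff_norm] at this ⊢
    refine Eq.trans ?_ this
    rw [← norm_neg]; congr 1; abel⟩
  have hA : Continuous A := by fun_prop
  have hAA : ∀ w, A (A w) = w := by intro w; apply Subtype.ext; simp [A]
  let k : Metric.sphere z r → ℝ := fun w => g w - g (A w)
  have hk : Continuous k := hg.sub (hg.comp hA)
  have hkA : ∀ w, k (A w) = - k w := by intro w; simp [k, hAA]
  let w0 : Metric.sphere z r := ⟨z + (r, 0), by
    rw [mem_sphere_iff_norm]; simp [Prod.norm_def, abs_of_pos hr, hr.le]⟩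
  have : (0 : ℝ) ∈ Set.range k := by
    rcases le_total (k w0) 0 with h | h
    · exact mem_range_of_exists_le_of_exists_ge hk ⟨w0, h⟩ ⟨A w0, by rw [hkA]; linarith⟩
    · exact mem_range_of_exists_le_of_exists_ge hk ⟨A w0, by rw [hkA]; linarith⟩ ⟨w0, h⟩
  obtain ⟨w, hw⟩ := this
  have h1 := hginj w (A w) (by simp only [k] at hw; linarith)
  have h2 : (w : Pt2) = z + z - w := congrArg Subtype.val h1
  have h3 : (w : Pt2) = z := by
    have h4 : (w : Pt2) + w = z + z := by rw [eq_sub_iff_add_eq] at h2; exact h2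
    have h5 : (2 : ℝ) • (w : Pt2) = (2 : ℝ) • z := by rw [two_smul, two_smul, h4]
    exact smul_right_injective Pt2 (two_ne_zero) h5
  have := w.2
  rw [h3, mem_sphere_iff_norm] at this
  simp at this
  linarith

lemma sd_edge_has_face (D : SimpDisk) (hns : D.Nonsingular) {e : Finset Pt2} (he : e ∈ D.edges) :
    (fcs D e).card ≠ 0 := by
  intro h0
  rw [Finset.card_eq_zero] at h0
  obtain ⟨a, b, hab, rfl⟩ := Finset.card_eq_two.1 (D.edge_card e he)
  obtain ⟨U, hUsub, hU, hmU⟩ := mem_nhds_iff.1 (sd_local D (midpoint ℝ a b))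
  have hmX : midpoint ℝ a b ∈ D.supp := sd_hull_sub D (sd_edge_cell D he) (by
    rw [Finset.coe_pair, convexHull_pair]; exact openSegment_subset_segment _ _ _ (sd_mid a b))
  have key : ∀ y ∈ U, y ∈ D.supp → cr a b y = 0 := by
    intro y hy hyX
    obtain ⟨s, hs, hys⟩ := (sd_mem_supp D).1 hyX
    have hsub := sd_edge_mem D hab he (sd_mid a b) hs (hUsub hy s hs hys)
    have hs' := hs
    simp only [SimpDisk.cells, Finset.mem_union, Finset.mem_image] at hs'
    rcases hs' with (⟨v, _, rfl⟩ | hs') | hs'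
    · have := Finset.card_le_card hsub
      rw [Finset.card_pair hab] at this; simp at this
    · have : s = {a, b} := (Finset.eq_of_subset_of_card_le hsub (by
        rw [D.edge_card s hs', Finset.card_pair hab])).symm
      subst this
      exact hull_pair_cr (by simpa using hys)
    · have : s ∈ fcs D {a, b} := by simp [fcs, hs', hsub]
      rw [h0] at this
      simp at this
  refine sd_N D hns hU hmU hmX (fun y => (b.1 - a.1) * y.1 + (b.2 - a.2) * y.2) (by fun_prop) ?_
  intro y hy hyX z hz hzX h
  have e1 := key y hy hyX
  have e2 := key z hz hzX
  have hne : (b.1 - a.1)^2 + (b.2 - a.2)^2 ≠ 0 := by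
    intro h
    apply hab
    have h1 : b.1 - a.1 = 0 := by nlinarith [sq_nonneg (b.1 - a.1), sq_nonneg (b.2 - a.2)]
    have h2 : b.2 - a.2 = 0 := by nlinarith [sq_nonneg (b.1 - a.1), sq_nonneg (b.2 - a.2)]
    ext <;> linarith
  unfold cr at e1 e2
  ext
  · apply mul_left_cancel₀ hne
    linear_combination (b.1 - a.1) * h - (b.2 - a.2) * e1 + (b.2 - a.2) * e2
  · apply mul_left_cancel₀ hne
    linear_combination (b.2 - a.2) * h + (b.1 - a.1) * e1 - (b.1 - a.1) * e2

lemma sd_face_split {s : Finset Pt2} (hs : s.card = 3) {v : Pt2} (hv : v ∈ s) :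
    ∃ a b, v ≠ a ∧ v ≠ b ∧ a ≠ b ∧ s = {v, a, b} := by
  have h2 : (s.erase v).card = 2 := by rw [Finset.card_erase_of_mem hv, hs]
  obtain ⟨a, b, hab, h⟩ := Finset.card_eq_two.1 h2
  have ha : a ∈ s.erase v := by rw [h]; simp
  have hb : b ∈ s.erase v := by rw [h]; simp
  refine ⟨a, b, (Finset.ne_of_mem_erase ha).symm, (Finset.ne_of_mem_erase hb).symm, hab, ?_⟩
  rw [← Finset.insert_erase hv, h]

lemma sd_face_edge (D : SimpDisk) {s : Finset Pt2} (hs : s ∈ D.facesD) {a b : Pt2} (hab : a ≠ b)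
    (ha : a ∈ s) (hb : b ∈ s) : ({a, b} : Finset Pt2) ∈ D.edges := by
  refine D.face_edges s hs _ ?_ (Finset.card_pair hab)
  intro x hx
  simp only [Finset.mem_insert, Finset.mem_singleton] at hx
  rcases hx with rfl | rfl <;> assumption

lemma sd_vert_has_edge (D : SimpDisk) (hns : D.Nonsingular) {v : Pt2} (hv : v ∈ D.verts) :
    ∃ e ∈ D.edges, v ∈ e := by
  by_contra hno
  push Not at hno
  obtain ⟨U, hUsub, hU, hmU⟩ := mem_nhds_iff.1 (sd_local D v)
  have hmX : v ∈ D.supp := sd_hull_sub D (sd_vert_cell D hv) (by simp)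
  have key : ∀ y ∈ U, y ∈ D.supp → y = v := by
    intro y hy hyX
    obtain ⟨s, hs, hys⟩ := (sd_mem_supp D).1 hyX
    have hvs := sd_vert_mem D hv hs (hUsub hy s hs hys)
    have hs' := hs
    simp only [SimpDisk.cells, Finset.mem_union, Finset.mem_image] at hs'
    rcases hs' with (⟨w, _, rfl⟩ | hs') | hs'
    · simp only [Finset.mem_singleton] at hvs
      subst hvs
      simpa using hys
    · exact absurd hvs (hno s hs')
    · obtain ⟨a, b, hva, hvb, hab, rfl⟩ := sd_face_split (D.face_card s hs') hvs
      exact absurd (by simp) (hno {v, a} (sd_face_edge D hs' hva (by simp) (by simp)))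
  refine sd_N D hns hU hmU hmX (fun _ => 0) (by fun_prop) ?_
  intro y hy hyX z hz hzX h
  rw [key y hy hyX, key z hz hzX]

lemma sd_vert_interior (D : SimpDisk) {v : Pt2} (hv : v ∈ D.verts)
    (hex : ∃ e ∈ D.edges, v ∈ e) (hall : ∀ e ∈ D.edges, v ∈ e → 1 < (fcs D e).card) :
    v ∈ interior D.supp := by
  obtain ⟨r0, hr0, hball⟩ := Metric.eventually_nhds_iff_ball.1 (sd_local D v)
  have hloc : ∀ x ∈ Metric.ball v r0, ∀ s ∈ D.cells, x ∈ convexHull ℝ (s : Set Pt2) → v ∈ s :=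
    fun x hx s hs hxs => sd_vert_mem D hv hs (hball x hx s hs hxs)
  have hedge : ∀ x ∈ Metric.ball v r0, x ≠ v → ∀ a, a ≠ v → ({v, a} : Finset Pt2) ∈ D.edges →
      x ∈ convexHull ℝ ({v, a} : Set Pt2) → x ∈ interior D.supp := by
    intro x hx hxv a hav he hxe
    apply sd_two_interior D hav.symm (hall _ he (by simp))
    rw [convexHull_pair] at hxe
    apply mem_openSegment_of_ne_left_right hxv.symm _ hxe
    rintro rfl
    have ha : a ∈ D.verts := D.edge_sub _ he (by simp)
    have := hloc a hx {a} (sd_vert_cell D ha) (by simp)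
    simp at this
    exact hav this.symm
  have hface : ∀ x ∈ Metric.ball v r0, x ≠ v → ∀ a b, v ≠ a → v ≠ b → a ≠ b → 0 < cr v a b →
      ({v, a, b} : Finset Pt2) ∈ D.facesD →
      x ∈ convexHull ℝ ({v, a, b} : Set Pt2) → x ∈ interior D.supp := by
    intro x hx hxv a b hva hvb hab hpos hf hxf
    rcases tri_cases hpos hxf with h | h | h | h
    · refine interior_mono ?_ h
      have := sd_hull_sub D (sd_face_cell D hf)
      simpa using this
    · exact hedge x hx hxv a hva.symm (sd_face_edge D hf hva (by simp) (by simp)) h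
    · exfalso
      have := hloc x hx {a, b} (sd_edge_cell D (sd_face_edge D hf hab (by simp) (by simp)))
        (by simpa using h)
      simp at this
      tauto
    · rw [Set.pair_comm] at h
      exact hedge x hx hxv b hvb.symm (sd_face_edge D hf hvb (by simp) (by simp)) h
  have hin : ∀ x ∈ Metric.ball v r0, x ≠ v → x ∈ D.supp → x ∈ interior D.supp := by
    intro x hx hxv hxX
    obtain ⟨s, hs, hys⟩ := (sd_mem_supp D).1 hxX
    have hvs := hloc x hx s hs hys
    have hs' := hs
    simp only [SimpDisk.cells, Finset.mem_union, Finset.mem_image] at hs'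
    rcases hs' with (⟨w, _, rfl⟩ | hs') | hs'
    · simp only [Finset.mem_singleton] at hvs
      subst hvs
      exact absurd (by simpa using hys) hxv
    · obtain ⟨a, b, hab, rfl⟩ := Finset.card_eq_two.1 (D.edge_card s hs')
      simp only [Finset.mem_insert, Finset.mem_singleton] at hvs
      rcases hvs with rfl | rfl
      · exact hedge x hx hxv b hab.symm hs' (by simpa using hys)
      · rw [Finset.pair_comm] at hs' hys
        exact hedge x hx hxv a hab hs' (by simpa using hys)
    · obtain ⟨a, b, hva, hvb, hab, rfl⟩ := sd_face_split (D.face_card s hs') hvs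
      obtain hne := not_collinear_cr hva (c := b) (by simpa using D.face_nondegen _ hs')
      rcases lt_or_gt_of_ne hne with h | h
      · have e : ({v, a, b} : Finset Pt2) = {v, b, a} := by rw [Finset.pair_comm]
        rw [e] at hs' hys
        refine hface x hx hxv b a hvb hva hab.symm ?_ hs' (by simpa using hys)
        rw [← cr_rot, cr_swap, cr_rot v a b]; linarith
      · exact hface x hx hxv a b hva hvb hab h hs' (by simpa using hys)
  obtain ⟨e, he, hve⟩ := hex
  obtain ⟨a, hav, hea⟩ : ∃ a, a ≠ v ∧ e = {v, a} := by
    obtain ⟨a, b, hab, rfl⟩ := Finset.card_eq_two.1 (D.edge_card e he)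
    simp only [Finset.mem_insert, Finset.mem_singleton] at hve
    rcases hve with rfl | rfl
    · exact ⟨b, hab.symm, rfl⟩
    · exact ⟨a, hab, Finset.pair_comm _ _⟩
  subst hea
  have har : r0 ≤ ‖a - v‖ := by
    by_contra hlt
    have ha : a ∈ D.verts := D.edge_sub _ he (by simp)
    have := hloc a (by rw [mem_ball_iff_norm]; linarith) {a} (sd_vert_cell D ha) (by simp)
    simp at this
    exact hav this.symm
  have hsph : ∀ r, 0 < r → r < r0 → Metric.sphere v r ⊆ interior D.supp := by
    intro r hr hrr
    have hb : Metric.sphere v r ⊆ Metric.ball v r0 := Metric.sphere_subset_ball hrr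
    have hn : ∀ x ∈ Metric.sphere v r, x ≠ v := by
      rintro x hx rfl
      simp at hx; linarith
    refine (isPreconnected_sphere pt2_rank v r).subset_left_of_subset_union isOpen_interior
      (sd_closed D).isOpen_compl ?_ ?_ ?_
    · rw [Set.disjoint_compl_right_iff_subset]; exact interior_subset
    · intro x hx
      by_cases hX : x ∈ D.supp
      · exact Or.inl (hin x (hb hx) (hn x hx) hX)
      · exact Or.inr hX
    · have hpos : 0 < ‖a - v‖ := by linarith
      have hsx : v + (r / ‖a - v‖) • (a - v) ∈ Metric.sphere v r := by
        rw [mem_sphere_iff_norm, add_sub_cancel_left, norm_smul, Real.norm_eq_abs,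
          abs_of_pos (by positivity)]
        field_simp
      refine ⟨_, hsx, hin _ (hb hsx) (hn _ hsx) ?_⟩
      apply sd_hull_sub D (sd_edge_cell D he)
      rw [Finset.coe_pair, convexHull_pair, segment_eq_image']
      refine ⟨r / ‖a - v‖, ⟨by positivity, ?_⟩, rfl⟩
      rw [div_le_one hpos]; linarith
  rw [mem_interior]
  refine ⟨Metric.ball v r0, ?_, Metric.isOpen_ball, Metric.mem_ball_self hr0⟩
  intro x hx
  by_cases hxv : x = v
  · subst hxv
    exact sd_hull_sub D (sd_vert_cell D hv) (by simp)
  · exact interior_subset (hsph (dist x v) (dist_pos.2 hxv) hx (Metric.mem_sphere.2 rfl))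


lemma sd_edges_in_face (D : SimpDisk) {t : Finset Pt2} (ht : t ∈ D.facesD) {v : Pt2} :
    ((D.edges.filter (fun e => v ∈ e)).filter (fun e => e ⊆ t)).card =
      if v ∈ t then 2 else 0 := by
  split_ifs with hv
  · obtain ⟨a, b, hva, hvb, hab, rfl⟩ := sd_face_split (D.face_card t ht) hv
    have e : (D.edges.filter (fun e => v ∈ e)).filter (fun e => e ⊆ {v, a, b}) =
        {({v, a} : Finset Pt2), {v, b}} := by
      ext e
      simp only [Finset.mem_filter, Finset.mem_insert, Finset.mem_singleton]
      constructor
      · rintro ⟨⟨he, hve⟩, hsub⟩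
        obtain ⟨x, y, hxy, rfl⟩ := Finset.card_eq_two.1 (D.edge_card e he)
        have hx := hsub (show x ∈ _ by simp)
        have hy := hsub (show y ∈ _ by simp)
        simp only [Finset.mem_insert, Finset.mem_singleton] at hve hx hy
        rcases hve with rfl | rfl
        · rcases hy with rfl | rfl | rfl
          · exact absurd rfl hxy
          · exact Or.inl rfl
          · exact Or.inr rfl
        · rcases hx with rfl | rfl | rfl
          · exact absurd rfl hxy
          · exact Or.inl (Finset.pair_comm _ _)
          · exact Or.inr (Finset.pair_comm _ _)
      · rintro (rfl | rfl)
        · refine ⟨⟨sd_face_edge D ht hva (by simp) (by simp), by simp⟩, ?_⟩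
          intro x; simp; tauto
        · refine ⟨⟨sd_face_edge D ht hvb (by simp) (by simp), by simp⟩, ?_⟩
          intro x; simp; tauto
    rw [e, Finset.card_pair]
    intro h
    have : a ∈ ({v, b} : Finset Pt2) := by rw [← h]; simp
    simp only [Finset.mem_insert, Finset.mem_singleton] at this
    rcases this with h | h
    · exact hva h.symm
    · exact hab h
  · rw [Finset.card_eq_zero, Finset.filter_eq_empty_iff]
    intro e he hsub
    exact hv (hsub (Finset.mem_filter.1 he).2)

/-- Every boundary vertex lies on at least two edges contained in exactly one face. -/
lemma sd_two_ones (D : SimpDisk) (hns : D.Nonsingular) {v : Pt2} (hv : D.BVert v) :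
    2 ≤ ((D.edges.filter (fun e => (fcs D e).card = 1)).filter (fun e => v ∈ e)).card := by
  set Ev := D.edges.filter (fun e => v ∈ e) with hEv
  have hsum : ∑ e ∈ Ev, (fcs D e).card = ∑ t ∈ D.facesD, if v ∈ t then 2 else 0 := by
    rw [← Finset.sum_congr rfl fun t ht => sd_edges_in_face D ht (v := v)]
    simp only [fcs, Finset.card_filter]
    rw [Finset.sum_comm]
  have heven : Even (∑ e ∈ Ev, (fcs D e).card) := by
    rw [hsum]
    apply Finset.even_sum
    intro t _
    split_ifs <;> decide
  have hsplit : ∑ e ∈ Ev, (fcs D e).card + (Ev.filter (fun e => (fcs D e).card = 1)).card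
      = 2 * Ev.card := by
    rw [Finset.card_filter, ← Finset.sum_add_distrib, mul_comm, ← smul_eq_mul,
      ← Finset.sum_const]
    apply Finset.sum_congr rfl
    intro e he
    have he' := (Finset.mem_filter.1 he).1
    have h1 := fcs_le_two D he'
    have h2 := sd_edge_has_face D hns he'
    split_ifs <;> omega
  have hne : (Ev.filter (fun e => (fcs D e).card = 1)).card ≠ 0 := by
    intro h0
    rw [Finset.card_eq_zero, Finset.filter_eq_empty_iff] at h0
    have := sd_vert_interior D hv.1 (sd_vert_has_edge D hns hv.1) (by
      intro e he hve
      have h1 := h0 (Finset.mem_filter.2 ⟨he, hve⟩)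
      have h2 := sd_edge_has_face D hns he
      omega)
    exact hv.2.2 this
  rw [Finset.filter_comm, ← hEv]
  rw [Nat.even_iff] at heven
  omega

lemma sd_sum_card (D : SimpDisk) (S : Finset (Finset Pt2)) (hS : S ⊆ D.edges) (W : Finset Pt2) :
    ∑ v ∈ W, (S.filter (fun e => v ∈ e)).card ≤ 2 * S.card := by
  simp only [Finset.card_filter]
  rw [Finset.sum_comm, mul_comm, ← smul_eq_mul, ← Finset.sum_const]
  apply Finset.sum_le_sum
  intro e he
  rw [← Finset.card_filter, ← D.edge_card e (hS he)]
  apply Finset.card_le_card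
  intro x hx
  exact (Finset.mem_filter.1 hx).2

lemma sd_three_faces (D : SimpDisk) :
    3 * D.facesD.card + (D.edges.filter (fun e => (fcs D e).card = 1)).card ≤ 2 * D.edges.card := by
  have h1 : ∑ e ∈ D.edges, (fcs D e).card = 3 * D.facesD.card := by
    simp only [fcs, Finset.card_filter]
    rw [Finset.sum_comm, mul_comm, ← smul_eq_mul, ← Finset.sum_const]
    apply Finset.sum_congr rfl
    intro t ht
    rw [← Finset.card_filter]
    have : D.edges.filter (fun e => e ⊆ t) = t.powersetCard 2 := by
      ext e
      simp only [Finset.mem_filter, Finset.mem_powersetCard]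
      constructor
      · rintro ⟨h1, h2⟩; exact ⟨h2, D.edge_card e h1⟩
      · rintro ⟨h1, h2⟩; exact ⟨D.face_edges t ht e h1 h2, h1⟩
    rw [this, Finset.card_powersetCard, D.face_card t ht]
    rfl
  rw [← h1, Finset.card_filter, ← Finset.sum_add_distrib, mul_comm 2, ← smul_eq_mul,
      ← Finset.sum_const]
  apply Finset.sum_le_sum
  intro e he
  have h1 := fcs_le_two D he
  split_ifs <;> omega

lemma sd_final (D : SimpDisk) (hns : D.Nonsingular)
    (hchi : D.edges.card + 1 ≤ D.verts.card + D.facesD.card)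
    (hcat : ∀ v : Pt2, D.IVert v → 6 ≤ D.deg v) :
    (∀ v, D.BVert v → 2 ≤ D.deg v) ∧
    6 ≤ ∑ v ∈ D.verts.filter (fun v => D.BVert v), (4 - (D.deg v : ℤ)) := by
  set E1 := D.edges.filter (fun e => (fcs D e).card = 1) with hE1
  have hB : ∀ v, D.BVert v → 2 ≤ (E1.filter (fun e => v ∈ e)).card := fun v hv =>
    sd_two_ones D hns hv
  constructor
  · intro v hv
    refine (hB v hv).trans ?_
    unfold SimpDisk.deg
    apply Finset.card_le_card
    apply Finset.filter_subset_filter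
    exact Finset.filter_subset _ _
  · set B := D.verts.filter (fun v => D.BVert v) with hBdef
    set I := D.verts.filter (fun v => ¬ D.BVert v) with hIdef
    have c1 : 2 * B.card ≤ 2 * E1.card := by
      refine le_trans ?_ (sd_sum_card D E1 (Finset.filter_subset _ _) B)
      rw [mul_comm, ← smul_eq_mul, ← Finset.sum_const]
      exact Finset.sum_le_sum fun v hv => hB v (Finset.mem_filter.1 hv).2
    have c2 := sd_three_faces D
    have c3 : ∑ v ∈ D.verts, D.deg v ≤ 2 * D.edges.card :=
      sd_sum_card D D.edges (Finset.Subset.refl _) D.verts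
    have c4 : 6 * I.card ≤ ∑ v ∈ I, D.deg v := by
      rw [mul_comm, ← smul_eq_mul, ← Finset.sum_const]
      apply Finset.sum_le_sum
      intro v hv
      obtain ⟨h1, h2⟩ := Finset.mem_filter.1 hv
      apply hcat v
      refine ⟨h1, ?_⟩
      by_contra h3
      apply h2
      refine ⟨h1, ?_⟩
      rw [(sd_closed D).frontier_eq]
      exact ⟨sd_hull_sub D (sd_vert_cell D h1) (by simp), h3⟩
    have c5 : ∑ v ∈ B, D.deg v + ∑ v ∈ I, D.deg v = ∑ v ∈ D.verts, D.deg v :=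
      Finset.sum_filter_add_sum_filter_not _ _ _
    have c6 : B.card + I.card = D.verts.card := Finset.card_filter_add_card_filter_not _
    rw [Finset.sum_sub_distrib, Finset.sum_const, ← Nat.cast_sum]
    simp only [nsmul_eq_mul]
    rw [← hE1] at c2
    omega

lemma sd_conclude (D : SimpDisk) (hns : D.Nonsingular)
    (hchi : D.edges.card + 1 ≤ D.verts.card + D.facesD.card)
    (hcat : ∀ v : Pt2, D.IVert v → 6 ≤ D.deg v)
    (α : EPath D.adj) (hα : D.IsBoundaryCycle α) :
    (((Finset.range α.len).image α.f).filter (fun v => 4 < D.deg v)).card + 6 ≤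
        2 * (((Finset.range α.len).image α.f).filter (fun v => D.deg v = 2)).card +
          (((Finset.range α.len).image α.f).filter (fun v => D.deg v = 3)).card ∧
      ((∀ v ∈ (Finset.range α.len).image α.f, D.deg v ≠ 2) →
        (((Finset.range α.len).image α.f).filter (fun v => 4 < D.deg v)).card + 6 ≤
          (((Finset.range α.len).image α.f).filter (fun v => D.deg v < 4)).card) := by
  obtain ⟨h2, h6⟩ := sd_final D hns hchi hcat
  have himg : (Finset.range α.len).image α.f = D.verts.filter (fun v => D.BVert v) := by
    ext v
    simp only [Finset.mem_image, Finset.mem_range, Finset.mem_filter]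
    constructor
    · rintro ⟨i, hi, rfl⟩
      have hb := hα.2.1 i hi
      have hv : α.f i ∈ D.verts := D.edge_sub _ hb.1 (by simp)
      refine ⟨hv, hv, hb.2 (subset_convexHull ℝ _ (by simp))⟩
    · rintro ⟨_, hv⟩
      obtain ⟨i, hi, hiv⟩ := hα.2.2.2 v hv
      rcases hi.lt_or_eq with hlt | heq
      · exact ⟨i, hlt, hiv⟩
      · have hlen : 0 < α.len := by
          have h2 := sd_two_ones D hns hv
          obtain ⟨e, he⟩ := Finset.card_pos.1 (lt_of_lt_of_le (by norm_num : 0 < 2) h2)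
          simp only [Finset.mem_filter] at he
          obtain ⟨j, hj, _⟩ := hα.2.2.1 e (sd_one_bedge D he.1.1 he.1.2)
          omega
        refine ⟨0, hlen, ?_⟩
        rw [← hiv, heq]
        exact hα.1.symm
  rw [himg]
  set B := D.verts.filter (fun v => D.BVert v)
  have hB2 : ∀ v ∈ B, 2 ≤ D.deg v := fun v hv => h2 v (Finset.mem_filter.1 hv).2
  have key : (B.filter (fun v => 4 < D.deg v)).card + 6 ≤
      2 * (B.filter (fun v => D.deg v = 2)).card + (B.filter (fun v => D.deg v = 3)).card := by
    have hle : ∑ v ∈ B, (4 - (D.deg v : ℤ)) ≤ ∑ v ∈ B, (2 * (if D.deg v = 2 then 1 else 0) +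
        (if D.deg v = 3 then 1 else 0) - (if 4 < D.deg v then 1 else 0) : ℤ) := by
      apply Finset.sum_le_sum
      intro v hv
      have := hB2 v hv
      split_ifs <;> omega
    replace hle := h6.trans hle
    rw [Finset.sum_sub_distrib, Finset.sum_add_distrib, ← Finset.mul_sum] at hle
    simp only [Finset.sum_boole] at hle
    omega
  refine ⟨key, fun hno => ?_⟩
  have z2 : (B.filter (fun v => D.deg v = 2)).card = 0 := by
    rw [Finset.card_eq_zero, Finset.filter_eq_empty_iff]
    exact fun v hv => hno v hv
  have z3 : (B.filter (fun v => D.deg v = 3)).card ≤ (B.filter (fun v => D.deg v < 4)).card := by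
    apply Finset.card_le_card
    intro v hv
    simp only [Finset.mem_filter] at hv ⊢
    exact ⟨hv.1, by omega⟩
  omega


/-! ### Vanishing of the first cohomology -/

/-- affine functions on the plane -/
def affF (P : ℝ × ℝ × ℝ) (x : Pt2) : ℝ := P.1 * x.1 + P.2.1 * x.2 + P.2.2

lemma affF_cont (P : ℝ × ℝ × ℝ) : Continuous (affF P) := by unfold affF; fun_prop

lemma affF_sub_hull (P Q : ℝ × ℝ × ℝ) {s : Set Pt2} {n : ℝ}
    (h : ∀ v ∈ s, affF P v - affF Q v = n) {x : Pt2} (hx : x ∈ convexHull ℝ s) :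
    affF P x - affF Q x = n := by
  have hc : Convex ℝ {x | affF P x - affF Q x = n} := by
    intro x hx y hy s t hs ht hst
    simp only [Set.mem_ofPred_eq] at *
    have : s = 1 - t := by linarith
    subst this
    simp only [affF, Prod.fst_add, Prod.snd_add, Prod.smul_fst, Prod.smul_snd, smul_eq_mul] at *
    linear_combination (1 - t) * hx + t * hy
  exact convexHull_min (t := {x | affF P x - affF Q x = n}) h hc hx

lemma exists_affF (D : SimpDisk) (ω : Pt2 → Pt2 → ℤ) (hself : ∀ u, ω u u = 0)
    {s : Finset Pt2} (hs : s ∈ D.cells) :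
    ∃ P : ℝ × ℝ × ℝ, ∃ u ∈ s, ∀ v ∈ s, affF P v = ω u v := by
  simp only [SimpDisk.cells, Finset.mem_union, Finset.mem_image] at hs
  rcases hs with (⟨w, _, rfl⟩ | hs') | hs'
  · refine ⟨(0, 0, 0), w, by simp, ?_⟩
    simp [affF, hself]
  · obtain ⟨a, b, hab, rfl⟩ := Finset.card_eq_two.1 (D.edge_card s hs')
    have hne : (b.1 - a.1)^2 + (b.2 - a.2)^2 ≠ 0 := by
      intro h
      apply hab
      have h1 : b.1 - a.1 = 0 := by nlinarith [sq_nonneg (b.1 - a.1), sq_nonneg (b.2 - a.2)]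
      have h2 : b.2 - a.2 = 0 := by nlinarith [sq_nonneg (b.1 - a.1), sq_nonneg (b.2 - a.2)]
      ext <;> linarith
    refine ⟨(ω a b * (b.1 - a.1) / ((b.1 - a.1)^2 + (b.2 - a.2)^2),
      ω a b * (b.2 - a.2) / ((b.1 - a.1)^2 + (b.2 - a.2)^2),
      - ω a b * ((b.1 - a.1) * a.1 + (b.2 - a.2) * a.2) /
        ((b.1 - a.1)^2 + (b.2 - a.2)^2)), a, by simp, ?_⟩
    simp only [Finset.mem_insert, Finset.mem_singleton, forall_eq_or_imp, forall_eq, affF, hself]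
    constructor
    · field_simp; push_cast; ring
    · field_simp; ring
  · obtain ⟨a, ha⟩ := Finset.card_pos.1 (by rw [D.face_card s hs']; norm_num : 0 < s.card)
    obtain ⟨b, c, hab, hac, hbc, rfl⟩ := sd_face_split (D.face_card s hs') ha
    obtain hne := not_collinear_cr hab (c := c) (by simpa using D.face_nondegen _ hs')
    refine ⟨((ω a b * (-(a.2 - c.2)) + ω a c * (-(b.2 - a.2))) / cr a b c,
      (ω a b * (a.1 - c.1) + ω a c * (b.1 - a.1)) / cr a b c,
      (ω a b * cr c a 0 + ω a c * cr a b 0) / cr a b c), a, by simp, ?_⟩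
    simp only [Finset.mem_insert, Finset.mem_singleton, forall_eq_or_imp, forall_eq, affF, hself]
    refine ⟨?_, ?_, ?_⟩
    · field_simp; simp [cr]; ring
    · field_simp; simp [cr]; ring
    · field_simp; simp [cr]; ring

lemma circle_eq {a b : ℝ} : ((a : ℝ) : AddCircle (1 : ℝ)) = (b : AddCircle (1 : ℝ)) ↔
    ∃ n : ℤ, a - b = n := by
  rw [← sub_eq_zero, ← AddCircle.coe_sub, AddCircle.coe_eq_zero_iff]
  simp [eq_comm]

/-- Lifting circle valued maps on a contractible space. -/
lemma circle_lift {X : Type} [TopologicalSpace X] [ContractibleSpace X] (g : X → AddCircle (1 : ℝ))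
    (hg : Continuous g) :
    ∃ G : X → ℝ, Continuous G ∧ ∀ x, ((G x : ℝ) : AddCircle (1 : ℝ)) = g x := by
  have h1 := (id_nullhomotopic X).comp_right (⟨g, hg⟩ : C(X, AddCircle (1 : ℝ)))
  obtain ⟨y, ⟨H⟩⟩ := h1
  obtain ⟨e, rfl⟩ := QuotientAddGroup.mk_surjective y
  have cov := AddCircle.isCoveringMap_coe (1 : ℝ)
  let K := H.symm
  let Lf := cov.liftHomotopy K.toContinuousMap (ContinuousMap.const X e) (by
    intro a; exact K.apply_zero a)
  refine ⟨fun x => Lf (1, x), by fun_prop, fun x => ?_⟩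
  have := congrFun (cov.liftHomotopy_lifts K.toContinuousMap (ContinuousMap.const X e) (by
    intro a; exact K.apply_zero a)) (1, x)
  exact this.trans (K.apply_one x)

lemma int_const {X : Type} [TopologicalSpace X] [PreconnectedSpace X] (K : X → ℝ)
    (hK : Continuous K) (hi : ∀ x, ∃ n : ℤ, K x = n) (x y : X) : K x = K y := by
  choose n hn using hi
  have hc : Continuous n := by
    rw [Int.isClosedEmbedding_coe_real.continuous_iff]
    convert hK using 1
    ext x; exact (hn x).symm
  rw [hn, hn, PreconnectedSpace.constant ‹_› hc (x := x) (y := y)]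

lemma sd_coboundary (D : SimpDisk) (ω : Pt2 → Pt2 → ℤ) (hself : ∀ u, ω u u = 0)
    (hcoc : ∀ s ∈ D.cells, ∀ u ∈ s, ∀ v ∈ s, ∀ w ∈ s, ω u v + ω v w = ω u w) :
    ∃ h : Pt2 → ℤ, ∀ s ∈ D.cells, ∀ u ∈ s, ∀ v ∈ s, ω u v = h v - h u := by
  have hP : ∀ s : D.cells, ∃ P : ℝ × ℝ × ℝ, ∃ u ∈ s.1, ∀ v ∈ s.1, affF P v = ω u v :=
    fun s => exists_affF D ω hself s.2
  choose P b hb hPv using hP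
  have hcell : ∀ x : D.supp, ∃ s : D.cells, (x : Pt2) ∈ convexHull ℝ (s.1 : Set Pt2) := by
    intro x
    obtain ⟨s, hs, hx⟩ := (sd_mem_supp D).1 x.2
    exact ⟨⟨s, hs⟩, hx⟩
  choose c hc using hcell
  let g : D.supp → AddCircle (1 : ℝ) := fun x => ((affF (P (c x)) x : ℝ) : AddCircle (1 : ℝ))
  have hg : ∀ (x : D.supp) (s : D.cells), (x : Pt2) ∈ convexHull ℝ (s.1 : Set Pt2) →
      g x = ((affF (P s) x : ℝ) : AddCircle (1 : ℝ)) := by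
    intro x s hx
    have hx2 : (x : Pt2) ∈ convexHull ℝ (((c x).1 ∩ s.1 : Finset Pt2) : Set Pt2) := by
      rw [← D.glue _ (c x).2 _ s.2]; exact ⟨hc x, hx⟩
    have hne : (((c x).1 ∩ s.1 : Finset Pt2) : Set Pt2).Nonempty := by
      rw [← convexHull_nonempty_iff (𝕜 := ℝ)]; exact ⟨_, hx2⟩
    obtain ⟨w, hw⟩ := hne
    have hw' := Finset.mem_inter.1 (Finset.mem_coe.1 hw)
    refine circle_eq.2 ⟨ω (b (c x)) w - ω (b s) w, ?_⟩
    refine affF_sub_hull _ _ ?_ hx2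
    intro v hv
    have hv' := Finset.mem_inter.1 (Finset.mem_coe.1 hv)
    rw [hPv _ v hv'.1, hPv _ v hv'.2]
    have e1 := hcoc _ (c x).2 _ (hb (c x)) w hw'.1 v hv'.1
    have e2 := hcoc _ s.2 _ (hb s) w hw'.2 v hv'.2
    rw [← e1, ← e2]
    push_cast; ring
  have hgc : Continuous g := by
    refine LocallyFinite.continuous (f := fun s : D.cells =>
      {x : D.supp | (x : Pt2) ∈ convexHull ℝ (s.1 : Set Pt2)}) (locallyFinite_of_finite _) ?_ ?_ ?_
    · ext x; simp only [Set.mem_iUnion, Set.mem_univ, iff_true]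
      exact ⟨c x, hc x⟩
    · intro s
      exact ((Finset.finite_toSet s.1).isClosed_convexHull ℝ).preimage continuous_subtype_val
    · intro s
      refine ContinuousOn.congr (f := fun x : D.supp =>
        ((affF (P s) x : ℝ) : AddCircle (1 : ℝ))) ?_ (fun x hx => hg x s hx)
      apply Continuous.continuousOn
      exact (AddCircle.isCoveringMap_coe (1 : ℝ)).continuous.comp
        ((affF_cont _).comp continuous_subtype_val)
  have hcon : ContractibleSpace D.supp := D.contractible
  obtain ⟨G, hGc, hG⟩ := circle_lift g hgc
  refine ⟨fun v => if hv : v ∈ D.supp then round (G ⟨v, hv⟩) else 0, ?_⟩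
  intro s hs u hu v hv
  have hsub := sd_hull_sub D hs
  have huh : u ∈ convexHull ℝ (s : Set Pt2) := subset_convexHull ℝ _ hu
  have hvh : v ∈ convexHull ℝ (s : Set Pt2) := subset_convexHull ℝ _ hv
  have : PreconnectedSpace (convexHull ℝ (s : Set Pt2)) :=
    Subtype.preconnectedSpace (convex_convexHull ℝ _).isPreconnected
  let K : convexHull ℝ (s : Set Pt2) → ℝ := fun x => G ⟨x, hsub x.2⟩ - affF (P ⟨s, hs⟩) x
  have hK : Continuous K := by
    refine Continuous.sub (hGc.comp (by fun_prop)) ((affF_cont _).comp continuous_subtype_val)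
  have hKi : ∀ x, ∃ n : ℤ, K x = n := by
    intro x
    apply circle_eq.1
    rw [hG]
    exact hg ⟨x, hsub x.2⟩ ⟨s, hs⟩ x.2
  have hconst := int_const K hK hKi ⟨u, huh⟩ ⟨v, hvh⟩
  obtain ⟨n, hn⟩ := hKi ⟨u, huh⟩
  rw [hconst] at hn
  rw [hn] at hconst
  simp only [K] at hconst hn
  rw [hPv ⟨s, hs⟩ u hu] at hconst
  rw [hPv ⟨s, hs⟩ v hv] at hn
  beta_reduce
  rw [dif_pos (hsub huh), dif_pos (hsub hvh)]
  have e1 : G ⟨u, hsub huh⟩ = ((n + ω (b ⟨s, hs⟩) u : ℤ) : ℝ) := by push_cast; linarith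
  have e2 : G ⟨v, hsub hvh⟩ = ((n + ω (b ⟨s, hs⟩) v : ℤ) : ℝ) := by push_cast; linarith
  rw [e1, e2, round_intCast, round_intCast]
  have := hcoc s hs _ (hb ⟨s, hs⟩) u hu v hv
  linarith


/-! ### Euler characteristic -/

/-- the value of a 1-cochain on an oriented pair of vertices -/
noncomputable def om (D : SimpDisk) {A : Type} [Ring A] (z : D.edges → A) (u v : Pt2) : A :=
  if toLex u < toLex v then (if h : ({u, v} : Finset Pt2) ∈ D.edges then z ⟨_, h⟩ else 0)
  else if toLex v < toLex u then
    (if h : ({v, u} : Finset Pt2) ∈ D.edges then - z ⟨_, h⟩ else 0)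
  else 0

lemma om_self (D : SimpDisk) {A : Type} [Ring A] (z : D.edges → A) (u : Pt2) :
    om D z u u = 0 := by simp [om]

lemma om_anti (D : SimpDisk) {A : Type} [Ring A] (z : D.edges → A) (u v : Pt2) :
    om D z u v = - om D z v u := by
  unfold om
  rcases lt_trichotomy (toLex u) (toLex v) with h | h | h
  · rw [if_pos h, if_neg h.asymm, if_pos h]
    split_ifs <;> simp
  · have : u = v := toLex.injective h
    subst this; simp
  · rw [if_neg h.asymm, if_pos h, if_pos h]
    split_ifs <;> simp

lemma om_lt (D : SimpDisk) {A : Type} [Ring A] (z : D.edges → A) {u v : Pt2}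
    (h : toLex u < toLex v) (he : ({u, v} : Finset Pt2) ∈ D.edges) :
    om D z u v = z ⟨_, he⟩ := by
  unfold om; rw [if_pos h, dif_pos he]

lemma om_scale (D : SimpDisk) (z : D.edges → ℤ) (c : D.edges → ℚ) (N : ℚ)
    (h : ∀ e, (z e : ℚ) = N * c e) (u v : Pt2) : ((om D z u v : ℤ) : ℚ) = N * om D c u v := by
  unfold om
  split_ifs <;> simp [h]

/-- `om` as a linear functional -/
noncomputable def omL (D : SimpDisk) (u v : Pt2) : (D.edges → ℚ) →ₗ[ℚ] ℚ where
  toFun c := om D c u v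
  map_add' c d := by
    unfold om; split_ifs <;> simp <;> ring
  map_smul' r c := by
    unfold om; split_ifs <;> simp

lemma sd_lohi (D : SimpDisk) (e : D.edges) :
    ∃ a b : Pt2, toLex a < toLex b ∧ e.1 = {a, b} := by
  obtain ⟨a, b, hab, h⟩ := Finset.card_eq_two.1 (D.edge_card e.1 e.2)
  rcases lt_or_gt_of_ne (fun h => hab (toLex.injective h) : toLex a ≠ toLex b) with h1 | h1
  · exact ⟨a, b, h1, h⟩
  · exact ⟨b, a, h1, by rw [h, Finset.pair_comm]⟩

lemma sd_chi (D : SimpDisk) : D.edges.card + 1 ≤ D.verts.card + D.facesD.card := by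
  choose lo hi hlt hlh using sd_lohi D
  have hlo : ∀ e, lo e ∈ D.verts := fun e => D.edge_sub e.1 e.2 (by rw [hlh]; simp)
  have hhi : ∀ e, hi e ∈ D.verts := fun e => D.edge_sub e.1 e.2 (by rw [hlh]; simp)
  have hf : ∀ t : D.facesD, ∃ x y z : Pt2, t.1 = {x, y, z} := by
    intro t
    obtain ⟨x, y, z, _, _, _, h⟩ := Finset.card_eq_three.1 (D.face_card t.1 t.2)
    exact ⟨x, y, z, h⟩
  choose x y z hxyz using hf
  let δ0 : (D.verts → ℚ) →ₗ[ℚ] (D.edges → ℚ) := LinearMap.pi fun e =>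
    (LinearMap.proj (⟨hi e, hhi e⟩ : D.verts) : (D.verts → ℚ) →ₗ[ℚ] ℚ) -
      LinearMap.proj (⟨lo e, hlo e⟩ : D.verts)
  let δ1 : (D.edges → ℚ) →ₗ[ℚ] (D.facesD → ℚ) := LinearMap.pi fun t =>
    omL D (x t) (y t) + omL D (y t) (z t) + omL D (z t) (x t)
  have hker : LinearMap.ker δ1 ≤ LinearMap.range δ0 := by
    intro c hc
    have hc' : ∀ t, om D c (x t) (y t) + om D c (y t) (z t) + om D c (z t) (x t) = 0 :=
      fun t => congrFun (LinearMap.mem_ker.1 hc) t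
    obtain ⟨⟨N, hN⟩, hNz⟩ := IsLocalization.exist_integer_multiples_of_finite
      (nonZeroDivisors ℤ) c
    have hN0 : (N : ℚ) ≠ 0 := by exact_mod_cast nonZeroDivisors.ne_zero hN
    choose k hk using hNz
    have hk' : ∀ e, (k e : ℚ) = (N : ℚ) * c e := by
      intro e; have := hk e; simpa using this
    have hsc := om_scale D k c N hk'
    have hcoc : ∀ s ∈ D.cells, ∀ u ∈ s, ∀ v ∈ s, ∀ w ∈ s,
        om D k u v + om D k v w = om D k u w := by
      intro s hs
      simp only [SimpDisk.cells, Finset.mem_union, Finset.mem_image] at hs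
      rcases hs with (⟨w, _, rfl⟩ | hs') | hs'
      · simp [om_self]
      · obtain ⟨a, b, hab, rfl⟩ := Finset.card_eq_two.1 (D.edge_card s hs')
        have h1 := om_anti D k a b
        simp only [Finset.mem_insert, Finset.mem_singleton]
        rintro u (rfl | rfl) v (rfl | rfl) w (rfl | rfl) <;> simp only [om_self] <;> linarith
      · have h0 := hc' ⟨s, hs'⟩
        have h1 := hxyz ⟨s, hs'⟩
        generalize x ⟨s, hs'⟩ = a at *
        generalize y ⟨s, hs'⟩ = b at *
        generalize z ⟨s, hs'⟩ = d at *
        simp only at h1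
        have h2 : om D k a b + om D k b d + om D k d a = 0 := by
          have : ((om D k a b + om D k b d + om D k d a : ℤ) : ℚ) = 0 := by
            push_cast
            rw [hsc, hsc, hsc, ← mul_add, ← mul_add, h0, mul_zero]
          exact_mod_cast this
        have i1 := om_anti D k a b
        have i2 := om_anti D k b d
        have i3 := om_anti D k d a
        rw [h1]
        simp only [Finset.mem_insert, Finset.mem_singleton]
        rintro u (rfl | rfl | rfl) v (rfl | rfl | rfl) w (rfl | rfl | rfl) <;>
          (try simp only [om_self]) <;> linarith
    obtain ⟨h, hh⟩ := sd_coboundary D (om D k) (om_self D k) hcoc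
    refine ⟨fun v => (h v : ℚ) / N, ?_⟩
    ext e
    change (h (hi e) : ℚ) / N - (h (lo e) : ℚ) / N = c e
    have he : e.1 ∈ D.cells := by
      simp only [SimpDisk.cells, Finset.mem_union]; exact Or.inl (Or.inr e.2)
    have h1 := hh e.1 he (lo e) (by rw [hlh]; simp) (hi e) (by rw [hlh]; simp)
    have hm : ({lo e, hi e} : Finset Pt2) ∈ D.edges := hlh e ▸ e.2
    rw [om_lt D k (hlt e) hm] at h1
    have h2 : (⟨{lo e, hi e}, hm⟩ : D.edges) = e := Subtype.ext (hlh e).symm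
    rw [h2] at h1
    have h3 : (k e : ℚ) = h (hi e) - h (lo e) := by exact_mod_cast h1
    rw [← sub_div, ← h3, hk' e]
    field_simp
  have r1 := LinearMap.finrank_range_add_finrank_ker δ1
  have r0 := LinearMap.finrank_range_add_finrank_ker δ0
  have m1 := Submodule.finrank_mono hker
  have m2 := Submodule.finrank_le (LinearMap.range δ1)
  simp only [Module.finrank_fintype_fun_eq_card, Fintype.card_coe] at r1 r0 m2
  have m3 : 1 ≤ Module.finrank ℚ (LinearMap.ker δ0) := by
    rw [Submodule.one_le_finrank_iff]
    intro hbot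
    have hmem : (fun _ => 1 : D.verts → ℚ) ∈ LinearMap.ker δ0 := by
      rw [LinearMap.mem_ker]; ext e
      change (1 : ℚ) - 1 = 0
      norm_num
    rw [hbot, Submodule.mem_bot] at hmem
    obtain ⟨v, hv⟩ := D.verts_nonempty
    have := congrFun hmem ⟨v, hv⟩
    simp at this
  omega

/-- Let `D` be a nonsingular CAT(0) simplicial disk (every interior vertex
has degree at least six) spanning a closed combinatorial path `α` (its boundary cycle).  Then
`2|α₂(D)| + |α₁(D)| ≥ |α₋(D)| + 6`, where `αᵢ(D)` is the set of vertices of `α` with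
`4 − deg = i` and `α₋(D)` the set of negative vertices (`deg > 4`).  In particular, if no
triangle moves can be applied to `α` (no vertex of `α` has degree `2` on `D`), then `α`
contains at least six more positive vertices (`deg < 4`) than negative vertices. -/
theorem statement_10 (D : SimpDisk) (hns : D.Nonsingular)
    (hcat : ∀ v : Pt2, D.IVert v → 6 ≤ D.deg v)
    (α : EPath D.adj) (hα : D.IsBoundaryCycle α) :
    (((Finset.range α.len).image α.f).filter (fun v => 4 < D.deg v)).card + 6 ≤
        2 * (((Finset.range α.len).image α.f).filter (fun v => D.deg v = 2)).card +
          (((Finset.range α.len).image α.f).filter (fun v => D.deg v = 3)).card ∧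
      ((∀ v ∈ (Finset.range α.len).image α.f, D.deg v ≠ 2) →
        (((Finset.range α.len).image α.f).filter (fun v => 4 < D.deg v)).card + 6 ≤
          (((Finset.range α.len).image α.f).filter (fun v => D.deg v < 4)).card) := by
  exact sd_conclude D hns (sd_chi D) hcat α hα
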